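/- arXiv:2307.13257 — 4 statements merged into one kernel-verified Lean document; each statement's English description precedes it below -/
import Mathlib

section
/- Any multiset of lines in ℝ² covering every point of T_2(n) at least three times has cardinality at least ⌈9n/4⌉, for all n ≥ 2. -/
open scoped Classical

/-- The triangular grid `T_d(n)`. -/
def TriGrid (d n : ℕ) : Set (Fin d → ℤ) :=
  {x | (∀ i, 0 ≤ x i) ∧ (∑ i, x i) ≤ (n : ℤ) - 1}

/-- Cast an integer point to a real point. -/
def toReal {d : ℕ} (x : Fin d → ℤ) : Fin d → ℝ := fun i => (x i : ℝ)

/-- Number of hyperplanes (with multiplicity) of the multiset `C` passing through `p`.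
A hyperplane is encoded as a pair `(a, b)` with `a ≠ 0`, representing `{p | ∑ i, a i * p i = b}`. -/
noncomputable def hypCount (d : ℕ) (C : Multiset ((Fin d → ℝ) × ℝ)) (p : Fin d → ℝ) : ℕ :=
  Multiset.countP (fun H => ∑ i, H.1 i * p i = H.2) C

namespace TriCover

/-- A line in barycentric form: the points `v` with `∑ i, H.1 i * v i = H.2`. -/
abbrev BLine := (Fin 3 → ℝ) × ℝ

/-- The line `H` passes through the lattice point `v` (in barycentric coordinates). -/
def OnPt (H : BLine) (v : Fin 3 → ℤ) : Prop :=
  H.1 0 * v 0 + H.1 1 * v 1 + H.1 2 * v 2 = H.2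

/-- In the plane of points with coordinate sum `M`, the line `H` contains the line `v i = c`. -/
def Cont (M : ℤ) (H : BLine) (i : Fin 3) (c : ℤ) : Prop :=
  H.1 (i + 1) = H.1 (i + 2) ∧ H.1 i * c + H.1 (i + 1) * (M - c) = H.2

/-- The line `H` is not parallel to the plane of constant coordinate sum. -/
def Nondeg (H : BLine) : Prop := ¬ (H.1 0 = H.1 1 ∧ H.1 1 = H.1 2)

/-- The points of the line `v i = c`, enumerated from `v (i + 1) = l` on. -/
def pt (M : ℤ) (i : Fin 3) (c l : ℤ) (t : ℕ) : Fin 3 → ℤ :=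
  fun j => if j = i then c else if j = i + 1 then l + t else M - c - l - t

/-- The number of points of a lattice segment on the line `v i = c` that lie on `H`. -/
noncomputable def hits (M : ℤ) (H : BLine) (i : Fin 3) (c l : ℤ) (L : ℕ) : ℕ :=
  ((Finset.range L).filter fun t => OnPt H (pt M i c l t)).card

lemma onPt_rot (H : BLine) (v : Fin 3 → ℤ) (i : Fin 3) :
    OnPt H v ↔ H.1 i * v i + H.1 (i + 1) * v (i + 1) + H.1 (i + 2) * v (i + 2) = H.2 := by
  unfold OnPt
  fin_cases i
  · simp
  · simp only [Fin.mk_one, Fin.isValue, show (1 : Fin 3) + 1 = 2 from rfl,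
      show (1 : Fin 3) + 2 = 0 from rfl]
    constructor <;> intro h <;> linarith
  · simp only [Fin.reduceFinMk, Fin.isValue, show (2 : Fin 3) + 1 = 0 from rfl,
      show (2 : Fin 3) + 2 = 1 from rfl]
    constructor <;> intro h <;> linarith

lemma sum_rot (v : Fin 3 → ℤ) (i : Fin 3) :
    v 0 + v 1 + v 2 = v i + v (i + 1) + v (i + 2) := by
  fin_cases i
  · simp
  · simp only [Fin.mk_one, Fin.isValue, show (1 : Fin 3) + 1 = 2 from rfl,
      show (1 : Fin 3) + 2 = 0 from rfl]
    ring
  · simp only [Fin.reduceFinMk, Fin.isValue, show (2 : Fin 3) + 1 = 0 from rfl,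
      show (2 : Fin 3) + 2 = 1 from rfl]
    ring

lemma nondeg_rot {H : BLine} (hH : Nondeg H) {i : Fin 3} (h : H.1 (i + 1) = H.1 (i + 2)) :
    H.1 i ≠ H.1 (i + 1) := by
  intro h'
  apply hH
  fin_cases i
  · exact ⟨h', h⟩
  · exact ⟨(h'.trans h).symm, h'⟩
  · exact ⟨h, h.symm.trans h'.symm⟩

lemma pt_self (M : ℤ) (i : Fin 3) (c l : ℤ) (t : ℕ) : pt M i c l t i = c := by simp [pt]

lemma pt_one (M : ℤ) (i : Fin 3) (c l : ℤ) (t : ℕ) : pt M i c l t (i + 1) = l + t := by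
  have : i + 1 ≠ i := by fin_cases i <;> decide
  simp [pt]

lemma pt_two (M : ℤ) (i : Fin 3) (c l : ℤ) (t : ℕ) :
    pt M i c l t (i + 2) = M - c - l - t := by
  have h1 : i + 2 ≠ i := by fin_cases i <;> decide
  have h2 : i + 2 ≠ i + 1 := by fin_cases i <;> decide
  simp only [pt, h1, h2, if_false]

lemma pt_sum (M : ℤ) (i : Fin 3) (c l : ℤ) (t : ℕ) :
    pt M i c l t 0 + pt M i c l t 1 + pt M i c l t 2 = M := by
  rw [sum_rot _ i, pt_self, pt_one, pt_two]; ring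

lemma Cont.eq_of_onPt {M : ℤ} {H : BLine} {i : Fin 3} {c : ℤ} (h : Cont M H i c)
    (hH : Nondeg H) {v : Fin 3 → ℤ} (hv : v 0 + v 1 + v 2 = M) (ho : OnPt H v) : v i = c := by
  rw [onPt_rot H v i] at ho
  rw [sum_rot v i] at hv
  obtain ⟨h1, h2⟩ := h
  have hne := nondeg_rot hH h1
  have hv' : (M : ℝ) = v i + v (i + 1) + v (i + 2) := by exact_mod_cast hv.symm
  have : (H.1 i - H.1 (i + 1)) * ((v i : ℝ) - c) = 0 := by
    rw [← h1] at ho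
    rw [hv'] at h2
    linear_combination ho - h2
  rcases mul_eq_zero.1 this with h | h
  · exact absurd (sub_eq_zero.1 h) hne
  · exact_mod_cast sub_eq_zero.1 h

lemma cont_of_onPt {M : ℤ} {H : BLine} {i : Fin 3} (h : H.1 (i + 1) = H.1 (i + 2))
    {v : Fin 3 → ℤ} (hv : v 0 + v 1 + v 2 = M) (ho : OnPt H v) : Cont M H i (v i) := by
  rw [onPt_rot H v i] at ho
  rw [sum_rot v i] at hv
  refine ⟨h, ?_⟩
  have hv' : (M : ℝ) = v i + v (i + 1) + v (i + 2) := by exact_mod_cast hv.symm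
  rw [← h] at ho
  rw [hv', ← ho]; ring

lemma Cont.unique {M : ℤ} {H : BLine} {i j : Fin 3} {c d : ℤ} (hH : Nondeg H)
    (h : Cont M H i c) (h' : Cont M H j d) : i = j ∧ c = d := by
  have hij : i = j := by
    by_contra hne
    apply hH
    have h1 := h.1
    have h2 := h'.1
    fin_cases i <;> fin_cases j <;> simp_all
  subst hij
  refine ⟨rfl, ?_⟩
  have hne := nondeg_rot hH h.1
  have : (H.1 i - H.1 (i + 1)) * ((c : ℝ) - d) = 0 := by
    linear_combination h.2 - h'.2
  rcases mul_eq_zero.1 this with h | h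
  · exact absurd (sub_eq_zero.1 h) hne
  · exact_mod_cast sub_eq_zero.1 h

lemma hits_le (M : ℤ) (H : BLine) (i : Fin 3) (c l : ℤ) (L : ℕ) : hits M H i c l L ≤ L :=
  (Finset.card_filter_le _ _).trans (Finset.card_range L).le

lemma hits_le_one {M : ℤ} {H : BLine} {i : Fin 3} {c : ℤ} (h : ¬ Cont M H i c) (l : ℤ) (L : ℕ) :
    hits M H i c l L ≤ 1 := by
  unfold hits
  rw [Finset.card_le_one]
  intro a ha b hb
  rw [Finset.mem_filter] at ha hb
  have ha' := ha.2
  have hb' := hb.2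
  rw [onPt_rot _ _ i, pt_self, pt_one, pt_two] at ha' hb'
  push_cast at ha' hb'
  by_contra hne
  apply h
  have h1 : H.1 (i + 1) = H.1 (i + 2) := by
    have : (H.1 (i + 1) - H.1 (i + 2)) * ((a : ℝ) - b) = 0 := by
      linear_combination ha' - hb'
    rcases mul_eq_zero.1 this with h | h
    · exact sub_eq_zero.1 h
    · exact absurd (by exact_mod_cast sub_eq_zero.1 h) hne
  have := cont_of_onPt h1 (pt_sum M i c l a) ha.2
  rwa [pt_self] at this

lemma exists_of_hits_ne_zero {M : ℤ} {H : BLine} {i : Fin 3} {c l : ℤ} {L : ℕ}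
    (h : hits M H i c l L ≠ 0) :
    ∃ v : Fin 3 → ℤ, v 0 + v 1 + v 2 = M ∧ OnPt H v ∧ v i = c ∧ l ≤ v (i + 1) ∧
      M - c - l - L + 1 ≤ v (i + 2) := by
  obtain ⟨t, ht⟩ := Finset.card_ne_zero.1 h
  rw [Finset.mem_filter, Finset.mem_range] at ht
  refine ⟨_, pt_sum M i c l t, ht.2, pt_self .., ?_, ?_⟩
  · rw [pt_one]; omega
  · rw [pt_two]; omega

lemma fin3_cases (i j : Fin 3) : j = i ∨ j = i + 1 ∨ j = i + 2 := by
  fin_cases i <;> fin_cases j <;> decide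

/-- The side `v i = p i` of the triangle with lower bounds `p`. -/
noncomputable def innerHits (M : ℤ) (p : Fin 3 → ℤ) (H : BLine) (i : Fin 3) : ℕ :=
  hits M H i (p i) (p (i + 1)) (M + 1 - (p 0 + p 1 + p 2)).toNat

/-- The shift applied to the ends of the outer segment when it would overlap an inner side. -/
noncomputable def trim (s p : Fin 3 → ℤ) (i : Fin 3) : ℤ := if s i = p i then 1 else 0

/-- The number of points of the outer segment on `v i = s i`. -/
noncomputable def outerLen (M : ℤ) (s p : Fin 3 → ℤ) (i : Fin 3) : ℕ :=
  (M + 1 - (p 0 + p 1 + p 2) + (p i - s i) - 2 * trim s p i).toNat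

/-- Incidences of `H` with the outer segment on `v i = s i`. -/
noncomputable def outerHits (M : ℤ) (s p : Fin 3 → ℤ) (H : BLine) (i : Fin 3) : ℕ :=
  hits M H i (s i) (p (i + 1) + trim s p i) (outerLen M s p i)

lemma exists_of_innerHits {M : ℤ} {p : Fin 3 → ℤ} {H : BLine} {i : Fin 3}
    (h : innerHits M p H i ≠ 0) :
    ∃ v : Fin 3 → ℤ, v 0 + v 1 + v 2 = M ∧ OnPt H v ∧ v i = p i ∧ ∀ j, p j ≤ v j := by
  obtain ⟨v, h1, h2, h3, h4, h5⟩ := exists_of_hits_ne_zero h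
  have hpos : (M + 1 - (p 0 + p 1 + p 2)).toNat ≠ 0 := fun h0 =>
    h (Nat.le_zero.1 ((hits_le ..).trans h0.le))
  refine ⟨v, h1, h2, h3, fun j => ?_⟩
  have := sum_rot p i
  rcases fin3_cases i j with rfl | rfl | rfl <;> omega

lemma exists_of_outerHits {M : ℤ} {s p : Fin 3 → ℤ} {H : BLine} {i : Fin 3}
    (h : outerHits M s p H i ≠ 0) :
    ∃ v : Fin 3 → ℤ, v 0 + v 1 + v 2 = M ∧ OnPt H v ∧ v i = s i ∧
      ∀ j, j ≠ i → p j + trim s p i ≤ v j := by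
  obtain ⟨v, h1, h2, h3, h4, h5⟩ := exists_of_hits_ne_zero h
  have hpos : outerLen M s p i ≠ 0 := fun h0 =>
    h (Nat.le_zero.1 ((hits_le ..).trans h0.le))
  unfold outerLen at h5 hpos
  refine ⟨v, h1, h2, h3, fun j hj => ?_⟩
  have := sum_rot p i
  rcases fin3_cases i j with rfl | rfl | rfl
  · exact absurd rfl hj
  · exact h4
  · omega

lemma trim_nonneg (s p : Fin 3 → ℤ) (i : Fin 3) : 0 ≤ trim s p i := by
  unfold trim; split_ifs <;> simp

/-- A line in general position meeting the outer segment of direction `i` misses both segments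
of direction `j`, if the third barycentric coefficient lies between the other two. -/
lemma separated {M : ℤ} {s p : Fin 3 → ℤ} {H : BLine} {i j k : Fin 3} (hsp : s i ≤ p i)
    (hij : j ≠ i) (hv : ∀ v : Fin 3 → ℤ, v 0 + v 1 + v 2 = v i + v j + v k)
    (ho : ∀ v : Fin 3 → ℤ, OnPt H v ↔ H.1 i * v i + H.1 j * v j + H.1 k * v k = H.2)
    (hlt : (H.1 i - H.1 k) * (H.1 j - H.1 k) < 0)
    (hi : outerHits M s p H i ≠ 0) {w : Fin 3 → ℤ} (hw : w 0 + w 1 + w 2 = M)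
    (hwo : OnPt H w) (hwj : w j ≤ p j) (hwi : p i ≤ w i) : False := by
  obtain ⟨v, h1, h2, h3, h4⟩ := exists_of_outerHits hi
  have h4 := h4 j hij
  have ht := trim_nonneg s p i
  rw [ho] at h2 hwo
  rw [hv] at h1 hw
  have e : ((v i : ℝ) + v j + v k) = w i + w j + w k := by exact_mod_cast h1.trans hw.symm
  have key : (H.1 i - H.1 k) * ((w i : ℝ) - v i) = (H.1 j - H.1 k) * ((v j : ℝ) - w j) := by
    linear_combination hwo - h2 + H.1 k * e
  have hx : (0 : ℝ) ≤ (w i : ℝ) - v i := by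
    have : (v i : ℝ) ≤ w i := by exact_mod_cast (by omega : v i ≤ w i)
    linarith
  have hy : (0 : ℝ) ≤ (v j : ℝ) - w j := by
    have : (w j : ℝ) ≤ v j := by exact_mod_cast (by omega : w j ≤ v j)
    linarith
  have both : (w i : ℝ) - v i = 0 ∧ (v j : ℝ) - w j = 0 := by
    rcases mul_neg_iff.1 hlt with ⟨ha, hb⟩ | ⟨ha, hb⟩
    · constructor <;> nlinarith
    · constructor <;> nlinarith
  have e1 : w i = v i := by exact_mod_cast sub_eq_zero.1 both.1
  have e2 : v j = w j := by exact_mod_cast sub_eq_zero.1 both.2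
  have : trim s p i = 1 := by unfold trim; rw [if_pos (by omega)]
  omega

lemma two_directions {M : ℤ} {s p : Fin 3 → ℤ} {H : BLine} {i j k : Fin 3}
    (hsp : ∀ i, s i ≤ p i)
    (hij : j ≠ i) (hv : ∀ v : Fin 3 → ℤ, v 0 + v 1 + v 2 = v i + v j + v k)
    (ho : ∀ v : Fin 3 → ℤ, OnPt H v ↔ H.1 i * v i + H.1 j * v j + H.1 k * v k = H.2)
    (hlt : (H.1 i - H.1 k) * (H.1 j - H.1 k) < 0)
    (hI : ∀ i, innerHits M p H i ≤ 1) (hO : ∀ i, outerHits M s p H i ≤ 1) :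
    innerHits M p H i + outerHits M s p H i + innerHits M p H j + outerHits M s p H j ≤ 2 := by
  have main : ∀ i j : Fin 3, j ≠ i →
      (∀ v : Fin 3 → ℤ, v 0 + v 1 + v 2 = v i + v j + v k) →
      (∀ v : Fin 3 → ℤ, OnPt H v ↔ H.1 i * v i + H.1 j * v j + H.1 k * v k = H.2) →
      (H.1 i - H.1 k) * (H.1 j - H.1 k) < 0 → outerHits M s p H i ≠ 0 →
      innerHits M p H j = 0 ∧ outerHits M s p H j = 0 := by
    intro i j hij hv ho hlt h
    constructor
    · by_contra hne
      obtain ⟨w, w1, w2, w3, w4⟩ := exists_of_innerHits hne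
      exact separated (hsp i) hij hv ho hlt h w1 w2 w3.le (w4 i)
    · by_contra hne
      obtain ⟨w, w1, w2, w3, w4⟩ := exists_of_outerHits hne
      refine separated (hsp i) hij hv ho hlt h w1 w2 (w3.trans_le (hsp j)) ?_
      have := w4 i hij.symm
      have := trim_nonneg s p j
      omega
  have h1 := main i j hij hv ho hlt
  have h2 := main j i hij.symm (fun v => by rw [hv]; ring)
    (fun v => by rw [ho]; constructor <;> intro h <;> linarith) (by linarith)
  have := hI i
  have := hI j
  have := hO i
  have := hO j
  omega

/-- Total number of incidences of `H` with the six segments. -/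
noncomputable def weight (M : ℤ) (s p : Fin 3 → ℤ) (H : BLine) : ℕ :=
  ∑ i, (innerHits M p H i + outerHits M s p H i)

/-- Number of peeled lines `v i = c`, `s i ≤ c < p i`, contained in `H`. -/
noncomputable def peeled (M : ℤ) (s p : Fin 3 → ℤ) (H : BLine) : ℕ :=
  ∑ i, ∑ c ∈ Finset.Ico (s i) (p i), if Cont M H i c then 1 else 0

/-- Bound on the excess weight over `4` of the line `v i = p i`. -/
noncomputable def excess (M : ℤ) (s p : Fin 3 → ℤ) (i : Fin 3) : ℕ :=
  (M + 1 - (p 0 + p 1 + p 2) + (if s i = p i then (outerLen M s p i : ℤ) else 0)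
    - trim s p (i + 1) - trim s p (i + 2)).toNat

lemma weight_rot (M : ℤ) (s p : Fin 3 → ℤ) (H : BLine) (i : Fin 3) :
    weight M s p H = (innerHits M p H i + outerHits M s p H i) +
      (innerHits M p H (i + 1) + outerHits M s p H (i + 1)) +
      (innerHits M p H (i + 2) + outerHits M s p H (i + 2)) := by
  have := sum_rot (fun i => ((innerHits M p H i + outerHits M s p H i : ℕ) : ℤ)) i
  rw [weight, Fin.sum_univ_three]
  exact_mod_cast this

lemma weight_le_four_of_not_cont {M : ℤ} {s p : Fin 3 → ℤ} {H : BLine}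
    (hsp : ∀ i, s i ≤ p i) (h : ∀ i c, ¬ Cont M H i c) : weight M s p H ≤ 4 := by
  have hI : ∀ i, innerHits M p H i ≤ 1 := fun i => hits_le_one (h i _) _ _
  have hO : ∀ i, outerHits M s p H i ≤ 1 := fun i => hits_le_one (h i _) _ _
  by_cases hd : ∃ i : Fin 3, H.1 (i + 1) = H.1 (i + 2)
  · obtain ⟨i, hi⟩ := hd
    have hI0 : ∀ j, innerHits M p H j = 0 := by
      intro j
      by_contra hne
      obtain ⟨v, h1, h2, -⟩ := exists_of_innerHits hne
      exact h i _ (cont_of_onPt hi h1 h2)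
    have hO0 : ∀ j, outerHits M s p H j = 0 := by
      intro j
      by_contra hne
      obtain ⟨v, h1, h2, -⟩ := exists_of_outerHits hne
      exact h i _ (cont_of_onPt hi h1 h2)
    simp [weight, hI0, hO0]
  · push Not at hd
    have hmed : ∃ k : Fin 3, (H.1 (k + 1) - H.1 k) * (H.1 (k + 2) - H.1 k) < 0 := by
      by_contra hcon
      push Not at hcon
      have d0 : H.1 1 ≠ H.1 2 := hd 0
      have d1 : H.1 2 ≠ H.1 0 := hd 1
      have d2 : H.1 0 ≠ H.1 1 := hd 2
      have c0 : 0 ≤ (H.1 1 - H.1 0) * (H.1 2 - H.1 0) := hcon 0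
      have c1 : 0 ≤ (H.1 2 - H.1 1) * (H.1 0 - H.1 1) := hcon 1
      have c2 : 0 ≤ (H.1 0 - H.1 2) * (H.1 1 - H.1 2) := hcon 2
      rcases lt_or_gt_of_ne d0 with a | a <;> rcases lt_or_gt_of_ne d1 with b | b <;>
        rcases lt_or_gt_of_ne d2 with c | c <;> nlinarith
    obtain ⟨k, hk⟩ := hmed
    have := two_directions (M := M) (s := s) (p := p) (H := H) (i := k + 1) (j := k + 2) (k := k)
      hsp (by fin_cases k <;> decide) (fun v => by rw [sum_rot v k]; ring)
      (fun v => by rw [onPt_rot H v k]; constructor <;> intro h <;> linarith) hk hI hO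
    rw [weight_rot M s p H k]
    have := hI k
    have := hO k
    omega

lemma peeled_eq_zero {M : ℤ} {s p : Fin 3 → ℤ} {H : BLine}
    (h : ∀ i c, s i ≤ c → c < p i → ¬ Cont M H i c) : peeled M s p H = 0 := by
  unfold peeled
  refine Finset.sum_eq_zero fun i _ => Finset.sum_eq_zero fun c hc => ?_
  rw [Finset.mem_Ico] at hc
  rw [if_neg (h i c hc.1 hc.2)]

lemma peeled_le_one {M : ℤ} {s p : Fin 3 → ℤ} {H : BLine} (hH : Nondeg H) {i : Fin 3} {c : ℤ}
    (h : Cont M H i c) : peeled M s p H ≤ 1 := by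
  unfold peeled
  rw [Finset.sum_eq_single i]
  · refine (Finset.sum_le_sum (g := fun d => if d = c then 1 else 0) fun d _ => ?_).trans ?_
    · by_cases hd : Cont M H i d
      · simp [hd, (h.unique hH hd).2]
      · simp [hd]
    · rw [Finset.sum_ite_eq']; split_ifs <;> simp
  · intro j _ hj
    refine Finset.sum_eq_zero fun d _ => if_neg fun hd => hj (hd.unique hH h).1
  · simp

lemma weight_le {M : ℤ} {s p : Fin 3 → ℤ} {H : BLine} (hH : Nondeg H)
    (hN : p 0 + p 1 + p 2 ≤ M + 1) (hsp : ∀ i, s i ≤ p i) :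
    weight M s p H + 4 * peeled M s p H ≤
      4 + ∑ i, ((if Cont M H i (s i) then if s i < p i then outerLen M s p i else 0 else 0) +
        if Cont M H i (p i) then excess M s p i else 0) := by
  by_cases hc : ∃ i c, Cont M H i c
  swap
  · push Not at hc
    rw [peeled_eq_zero fun i c _ _ => hc i c]
    have := weight_le_four_of_not_cont (s := s) (p := p) hsp hc
    omega
  obtain ⟨i, c, h⟩ := hc
  refine le_trans ?_ (Nat.add_le_add_left (Finset.single_le_sum (f := fun i =>
    ((if Cont M H i (s i) then if s i < p i then outerLen M s p i else 0 else 0) +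
        if Cont M H i (p i) then excess M s p i else 0)) (fun _ _ => Nat.zero_le _)
      (Finset.mem_univ i)) 4)
  rw [weight_rot M s p H i]
  have hIi : p i ≠ c → innerHits M p H i = 0 := by
    intro hne
    by_contra h0
    obtain ⟨v, h1, h2, h3, -⟩ := exists_of_innerHits h0
    exact hne (h3.symm.trans (h.eq_of_onPt hH h1 h2))
  have hOi : s i ≠ c → outerHits M s p H i = 0 := by
    intro hne
    by_contra h0
    obtain ⟨v, h1, h2, h3, -⟩ := exists_of_outerHits h0
    exact hne (h3.symm.trans (h.eq_of_onPt hH h1 h2))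
  have hI1 : ∀ j, j ≠ i → innerHits M p H j ≤ 1 :=
    fun j hj => hits_le_one (fun h' => hj (h'.unique hH h).1) _ _
  have hO1 : ∀ j, j ≠ i → outerHits M s p H j ≤ 1 :=
    fun j hj => hits_le_one (fun h' => hj (h'.unique hH h).1) _ _
  have hIj : c < p i → ∀ j, innerHits M p H j = 0 := by
    intro hlt j
    by_contra h0
    obtain ⟨v, h1, h2, -, h3⟩ := exists_of_innerHits h0
    have := h.eq_of_onPt hH h1 h2
    have := h3 i
    omega
  have hOj : ∀ j, j ≠ i → c < p i + trim s p j → outerHits M s p H j = 0 := by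
    intro j hj hlt
    by_contra h0
    obtain ⟨v, h1, h2, -, h3⟩ := exists_of_outerHits h0
    have := h.eq_of_onPt hH h1 h2
    have := h3 i hj.symm
    omega
  have ni1 : i + 1 ≠ i := by fin_cases i <;> decide
  have ni2 : i + 2 ≠ i := by fin_cases i <;> decide
  have hOL : outerHits M s p H i ≤ outerLen M s p i := hits_le ..
  have hIL : innerHits M p H i ≤ (M + 1 - (p 0 + p 1 + p 2)).toNat := hits_le ..
  have t1 := trim_nonneg s p (i + 1)
  have t2 := trim_nonneg s p (i + 2)
  have a1 := hI1 _ ni1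
  have a2 := hI1 _ ni2
  have b1 := hO1 _ ni1
  have b2 := hO1 _ ni2
  have o1 := hOj _ ni1
  have o2 := hOj _ ni2
  have hs := hsp i
  rcases lt_trichotomy c (p i) with hlt | heq | hgt
  · have := hIj hlt i
    have := hIj hlt (i + 1)
    have := hIj hlt (i + 2)
    have := o1 (by omega)
    have := o2 (by omega)
    have hp := peeled_le_one (s := s) (p := p) hH h
    by_cases hsc : s i = c
    · rw [if_pos (hsc.symm ▸ h), if_pos (hsc ▸ hlt)]
      omega
    · have := hOi hsc
      omega
  · subst heq
    rw [if_pos h, peeled_eq_zero fun j d h1 h2 h' => by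
      obtain ⟨rfl, rfl⟩ := h'.unique hH h
      exact lt_irrefl _ h2]
    have u1 : trim s p (i + 1) = 0 ∨ trim s p (i + 1) = 1 := by unfold trim; split_ifs <;> simp
    have u2 : trim s p (i + 2) = 0 ∨ trim s p (i + 2) = 1 := by unfold trim; split_ifs <;> simp
    unfold excess
    by_cases he : s i = p i
    · rw [if_pos he]
      omega
    · have := hOi he
      rw [if_neg he]
      omega
  · have := hIi hgt.ne
    have := hOi (by omega)
    rw [peeled_eq_zero fun j d h1 h2 h' => by
      obtain ⟨rfl, rfl⟩ := h'.unique hH h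
      omega]
    omega

lemma sum_hits (M : ℤ) (C : Multiset BLine) (i : Fin 3) (c l : ℤ) (L : ℕ) :
    (C.map fun H => hits M H i c l L).sum =
      ∑ t ∈ Finset.range L, C.countP fun H => OnPt H (pt M i c l t) := by
  induction C using Multiset.induction_on with
  | empty => simp
  | cons H C ih =>
    simp only [Multiset.map_cons, Multiset.sum_cons, ih, Multiset.countP_cons,
      Finset.sum_add_distrib]
    rw [hits, Finset.card_filter, add_comm]

lemma le_sum_hits {M : ℤ} {C : Multiset BLine} {i : Fin 3} {c l : ℤ} {L : ℕ}
    (h : ∀ t < L, 3 ≤ C.countP fun H => OnPt H (pt M i c l t)) :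
    3 * L ≤ (C.map fun H => hits M H i c l L).sum := by
  rw [sum_hits]
  calc 3 * L = ∑ t ∈ Finset.range L, 3 := by simp [mul_comm]
    _ ≤ _ := Finset.sum_le_sum fun t ht => h t (Finset.mem_range.1 ht)

lemma sum_map_ite (C : Multiset BLine) (q : BLine → Prop) (k : ℕ) :
    (C.map fun H => if q H then k else 0).sum = C.countP q * k := by
  induction C using Multiset.induction_on with
  | empty => simp
  | cons H C ih =>
    simp only [Multiset.map_cons, Multiset.sum_cons, ih, Multiset.countP_cons]
    split_ifs <;> ring

lemma exists_maximal_peeling (M : ℤ) (C : Multiset BLine) (s : Fin 3 → ℤ)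
    (hs : s 0 + s 1 + s 2 ≤ M + 1) :
    ∃ p : Fin 3 → ℤ, (∀ i, s i ≤ p i) ∧ p 0 + p 1 + p 2 ≤ M + 1 ∧
      (∀ i c, s i ≤ c → c < p i → 2 ≤ C.countP fun H => Cont M H i c) ∧
      (p 0 + p 1 + p 2 = M + 1 ∨ ∀ i, (C.countP fun H => Cont M H i (p i)) ≤ 1) := by
  suffices key : ∀ (k : ℕ) (p : Fin 3 → ℤ), M + 1 - (p 0 + p 1 + p 2) = k → (∀ i, s i ≤ p i) →
      (∀ i c, s i ≤ c → c < p i → 2 ≤ C.countP fun H => Cont M H i c) → _ by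
    exact key (M + 1 - (s 0 + s 1 + s 2)).toNat s (by omega) (fun _ => le_rfl)
      fun i c h1 h2 => by omega
  intro k
  induction k with
  | zero => exact fun p hk h1 h2 => ⟨p, h1, by omega, h2, Or.inl (by omega)⟩
  | succ k ih =>
    intro p hk h1 h2
    by_cases hm : ∀ i, (C.countP fun H => Cont M H i (p i)) ≤ 1
    · exact ⟨p, h1, by omega, h2, Or.inr hm⟩
    · push Not at hm
      obtain ⟨i, hi⟩ := hm
      have hself : Function.update p i (p i + 1) i = p i + 1 := Function.update_self ..
      have hoth : ∀ j, j ≠ i → Function.update p i (p i + 1) j = p j :=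
        fun j hj => Function.update_of_ne hj ..
      refine ih (Function.update p i (p i + 1)) ?_ (fun j => ?_) (fun j c hc1 hc2 => ?_)
      · rw [sum_rot _ i] at hk ⊢
        rw [hself, hoth _ (by fin_cases i <;> decide), hoth _ (by fin_cases i <;> decide)]
        push_cast at hk
        omega
      · by_cases hj : j = i
        · subst hj; rw [hself]; have := h1 j; omega
        · rw [hoth j hj]; exact h1 j
      · by_cases hj : j = i
        · subst hj
          rw [hself] at hc2
          by_cases hcp : c = p j
          · subst hcp; exact hi
          · exact h2 j c hc1 (by omega)
        · rw [hoth j hj] at hc2; exact h2 j c hc1 hc2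

/-- The counting bound when no side of the triangle is used three times. -/
lemma card_bound_of_sides {M : ℤ} {C : Multiset BLine} (hC : ∀ H ∈ C, Nondeg H)
    {s : Fin 3 → ℤ} (hs : s 0 + s 1 + s 2 ≤ M + 1)
    (hcov : ∀ v : Fin 3 → ℤ, v 0 + v 1 + v 2 = M → (∀ i, s i ≤ v i) →
      3 ≤ C.countP fun H => OnPt H v)
    (hside : ∀ i, (C.countP fun H => Cont M H i (s i)) ≤ 2) :
    9 * (M + 1 - (s 0 + s 1 + s 2)) ≤ 4 * (Multiset.card C : ℤ) := by
  obtain ⟨p, hsp, hN, hdouble, hmax⟩ := exists_maximal_peeling M C s hs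
  set N := (M + 1 - (p 0 + p 1 + p 2)).toNat with hNdef
  have hI : ∀ i, 3 * N ≤ (C.map fun H => innerHits M p H i).sum := by
    intro i
    refine le_sum_hits fun t ht => hcov _ (pt_sum ..) fun j => ?_
    have := sum_rot p i
    have := hsp j
    rcases fin3_cases i j with rfl | rfl | rfl
    · rw [pt_self]; omega
    · rw [pt_one]; omega
    · rw [pt_two]; omega
  have hO : ∀ i, 3 * outerLen M s p i ≤ (C.map fun H => outerHits M s p H i).sum := by
    intro i
    refine le_sum_hits fun t ht => hcov _ (pt_sum ..) fun j => ?_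
    have := sum_rot p i
    have := hsp j
    have := trim_nonneg s p i
    unfold outerLen at ht
    rcases fin3_cases i j with rfl | rfl | rfl
    · rw [pt_self]
    · rw [pt_one]; omega
    · rw [pt_two]; omega
  have hW : ∑ i, (3 * N + 3 * outerLen M s p i) ≤ (C.map fun H => weight M s p H).sum := by
    unfold weight
    rw [Multiset.sum_map_sum]
    refine Finset.sum_le_sum fun i _ => ?_
    rw [Multiset.sum_map_add]
    exact add_le_add (hI i) (hO i)
  have hP : ∑ i, 2 * (p i - s i).toNat ≤ (C.map fun H => peeled M s p H).sum := by
    unfold peeled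
    rw [Multiset.sum_map_sum]
    refine Finset.sum_le_sum fun i _ => ?_
    rw [Multiset.sum_map_sum]
    calc 2 * (p i - s i).toNat = ∑ c ∈ Finset.Ico (s i) (p i), 2 := by simp [mul_comm]
      _ ≤ _ := Finset.sum_le_sum fun c hc => by
        rw [Finset.mem_Ico] at hc
        rw [sum_map_ite, mul_one]
        exact hdouble i c hc.1 hc.2
  have hE : (C.map fun H => ∑ i, ((if Cont M H i (s i) then if s i < p i then outerLen M s p i else 0 else 0) +
        if Cont M H i (p i) then excess M s p i else 0)).sum ≤
      ∑ i, ((if s i < p i then 2 * outerLen M s p i else 0) + excess M s p i) := by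
    rw [Multiset.sum_map_sum]
    refine Finset.sum_le_sum fun i _ => ?_
    rw [Multiset.sum_map_add, sum_map_ite, sum_map_ite]
    refine add_le_add ?_ ?_
    · by_cases hlt : s i < p i
      · simp only [hlt, if_true]
        exact Nat.mul_le_mul_right _ (hside i)
      · simp [hlt]
    · rcases hmax with h0 | h1
      · have : excess M s p i = 0 := by
          have := trim_nonneg s p (i + 1)
          have := trim_nonneg s p (i + 2)
          unfold excess outerLen
          by_cases he : s i = p i
          · simp only [he, if_true, trim]
            simp only [trim] at *
            omega
          · simp only [he, if_false]
            omega
        simp [this]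
      · calc _ ≤ 1 * excess M s p i := Nat.mul_le_mul_right _ (h1 i)
          _ = _ := one_mul _
  have hT : (C.map fun H => weight M s p H).sum + 4 * (C.map fun H => peeled M s p H).sum ≤
      4 * Multiset.card C + (C.map fun H =>
        ∑ i, ((if Cont M H i (s i) then if s i < p i then outerLen M s p i else 0 else 0) +
        if Cont M H i (p i) then excess M s p i else 0)).sum := by
    have := Multiset.sum_map_le_sum_map _ _ fun H hH => weight_le (s := s) (hC H hH) hN hsp
    rw [Multiset.sum_map_add, Multiset.sum_map_add, Multiset.sum_map_mul_left] at this
    simpa [mul_comm] using this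
  have hfin := (add_le_add hW (Nat.mul_le_mul_left 4 hP)).trans
    (hT.trans (Nat.add_le_add_left hE _))
  simp only [Fin.sum_univ_three] at hfin
  have hcmp : ∀ i, (s i < p i ∧ s i ≠ p i) ∨ (¬ s i < p i ∧ s i = p i) := fun i => by
    have := hsp i
    omega
  simp only [excess, outerLen, trim, show (0 : Fin 3) + 1 = 1 from rfl,
    show (0 : Fin 3) + 2 = 2 from rfl, show (1 : Fin 3) + 1 = 2 from rfl,
    show (1 : Fin 3) + 2 = 0 from rfl, show (2 : Fin 3) + 1 = 0 from rfl,
    show (2 : Fin 3) + 2 = 1 from rfl] at hfin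
  rcases hcmp 0 with ⟨h0, e0⟩ | ⟨h0, e0⟩ <;> rcases hcmp 1 with ⟨h1, e1⟩ | ⟨h1, e1⟩ <;>
    rcases hcmp 2 with ⟨h2, e2⟩ | ⟨h2, e2⟩ <;>
    simp only [h0, h1, h2, e0, e1, e2, lt_irrefl, if_true, if_false] at hfin <;> omega

/-- A triangle of side `n = M + 1 - ∑ i, s i` covered three times needs at least `9 n / 4` lines. -/
theorem card_bound {M : ℤ} {C : Multiset BLine} (hC : ∀ H ∈ C, Nondeg H)
    {s : Fin 3 → ℤ} (hs : s 0 + s 1 + s 2 ≤ M + 1)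
    (hcov : ∀ v : Fin 3 → ℤ, v 0 + v 1 + v 2 = M → (∀ i, s i ≤ v i) →
      3 ≤ C.countP fun H => OnPt H v) :
    9 * (M + 1 - (s 0 + s 1 + s 2)) ≤ 4 * (Multiset.card C : ℤ) := by
  obtain ⟨n, hn⟩ : ∃ n : ℕ, M + 1 - (s 0 + s 1 + s 2) = n :=
    ⟨(M + 1 - (s 0 + s 1 + s 2)).toNat, by omega⟩
  induction n generalizing s C with
  | zero => omega
  | succ n ih =>
    by_cases hside : ∀ i, (C.countP fun H => Cont M H i (s i)) ≤ 2
    · exact card_bound_of_sides hC hs hcov hside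
    push Not at hside
    obtain ⟨i, hi⟩ := hside
    have hself : Function.update s i (s i + 1) i = s i + 1 := Function.update_self ..
    have hoth : ∀ j, j ≠ i → Function.update s i (s i + 1) j = s j :=
      fun j hj => Function.update_of_ne hj ..
    have hsum : Function.update s i (s i + 1) 0 + Function.update s i (s i + 1) 1 +
        Function.update s i (s i + 1) 2 = s 0 + s 1 + s 2 + 1 := by
      rw [sum_rot _ i, sum_rot s i, hself, hoth _ (by fin_cases i <;> decide),
        hoth _ (by fin_cases i <;> decide)]
      ring
    have hcard : (C.countP fun H => Cont M H i (s i)) +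
        Multiset.card (C.filter fun H => ¬ Cont M H i (s i)) = Multiset.card C := by
      rw [Multiset.countP_eq_card_filter, ← Multiset.card_add, Multiset.filter_add_not]
    have := ih (C := C.filter fun H => ¬ Cont M H i (s i)) (s := Function.update s i (s i + 1))
      (fun H hH => hC H (Multiset.mem_of_mem_filter hH)) (by push_cast at hn; omega)
      (fun v hv hsv => ?_) (by push_cast at hn; omega)
    · push_cast at hn
      omega
    · have hvi := hsv i
      rw [hself] at hvi
      have hle := hcov v hv fun j => by
        by_cases hj : j = i
        · subst hj; omega
        · exact (hoth j hj).symm.trans_le (hsv j)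
      rw [Multiset.countP_filter]
      refine hle.trans_eq (Multiset.countP_congr rfl fun H hH => ?_)
      simp only [eq_iff_iff]
      refine ⟨fun ho => ⟨ho, fun hcont => ?_⟩, fun h => h.1⟩
      have := hcont.eq_of_onPt (hC H hH) hv ho
      omega

end TriCover

theorem stmt4 (n : ℕ) (hn : 2 ≤ n)
    (C : Multiset ((Fin 2 → ℝ) × ℝ))
    (hC : ∀ H ∈ C, H.1 ≠ 0)
    (hcov : ∀ x ∈ TriGrid 2 n, 3 ≤ hypCount 2 C (toReal x)) :
    (9 * n + 3) / 4 ≤ Multiset.card C := by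
  have key := TriCover.card_bound (M := (n : ℤ) - 1)
    (C := C.map fun H => ((![H.1 0, H.1 1, 0], H.2) : TriCover.BLine)) (s := fun _ => 0) ?_ (by omega) ?_
  · rw [Multiset.card_map] at key
    omega
  · intro H hH
    obtain ⟨H, hmem, rfl⟩ := Multiset.mem_map.1 hH
    rintro ⟨h1, h2⟩
    simp only [Matrix.cons_val_zero, Matrix.cons_val_one, Matrix.cons_val] at h1 h2
    apply hC H hmem
    funext i
    fin_cases i
    · exact h1.trans h2
    · exact h2
  · intro v hv hv0
    have h3 := hcov ![v 0, v 1] ⟨fun i => ?_, ?_⟩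
    · rw [hypCount] at h3
      rw [Multiset.countP_map, ← Multiset.countP_eq_card_filter]
      simpa [TriCover.OnPt, toReal, Fin.sum_univ_two] using h3
    · fin_cases i
      · exact hv0 0
      · exact hv0 1
    · have := hv0 2
      simp only [Fin.sum_univ_two, Matrix.cons_val_zero, Matrix.cons_val_one]
      omega
end

section
/- For every integer j ≥ 0, the minimum total weight of a fractional line cover of T_2(3j+2) equals 2j + 1 + (2j+1)/(3j+2). -/
open scoped Classical

/-- The total weight of a finitely-supported weight assignment on hyperplanes. -/
noncomputable def fracTotal {d : ℕ} (w : ((Fin d → ℝ) × ℝ) →₀ ℝ) : ℝ :=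
  ∑ H ∈ w.support, w H

/-- The total weight of hyperplanes passing through the point `p`. -/
noncomputable def fracAt {d : ℕ} (w : ((Fin d → ℝ) × ℝ) →₀ ℝ) (p : Fin d → ℝ) : ℝ :=
  ∑ H ∈ w.support.filter (fun H => ∑ i, H.1 i * p i = H.2), w H

/-- `w` is a fractional cover of `T_d(n)`: nonnegative weights on genuine hyperplanes such that
every grid point lies on hyperplanes of total weight at least `1`. -/
def IsFracCover (d n : ℕ) (w : ((Fin d → ℝ) × ℝ) →₀ ℝ) : Prop :=
  (∀ H, 0 ≤ w H) ∧ (∀ H ∈ w.support, H.1 ≠ 0) ∧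
  ∀ x ∈ TriGrid d n, 1 ≤ fracAt w (toReal x)

theorem fracTotal_eq_linearCombination {d : ℕ} (w : ((Fin d → ℝ) × ℝ) →₀ ℝ) :
    fracTotal w = Finsupp.linearCombination ℝ (fun _ => (1 : ℝ)) w := by
  simp [fracTotal, Finsupp.linearCombination_apply, Finsupp.sum]

theorem fracAt_eq_linearCombination {d : ℕ} (w : ((Fin d → ℝ) × ℝ) →₀ ℝ) (p : Fin d → ℝ) :
    fracAt w p = Finsupp.linearCombination ℝ
      (fun H : (Fin d → ℝ) × ℝ => if ∑ i, H.1 i * p i = H.2 then (1 : ℝ) else 0) w := by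
  simp [fracAt, Finsupp.linearCombination_apply, Finsupp.sum, Finset.sum_filter]

namespace TriCover

/-! ### An optimal cover -/

/-- The weight of the `i`-th line in each of the three grid directions. -/
noncomputable def coverWeight (j i : ℕ) : ℝ := (2 * (j : ℝ) + 1 - i) / (3 * (j : ℝ) + 2)

/-- A cover by lines in the three grid directions. -/
noncomputable def cover (j : ℕ) : ((Fin 2 → ℝ) × ℝ) →₀ ℝ :=
  ∑ i ∈ Finset.range (2 * j + 1),
    (Finsupp.single (![1, 0], (i : ℝ)) (coverWeight j i) +
      Finsupp.single (![0, 1], (i : ℝ)) (coverWeight j i) +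
      Finsupp.single (![1, 1], 3 * (j : ℝ) + 1 - i) (coverWeight j i))

theorem coverWeight_nonneg {j i : ℕ} (hi : i ∈ Finset.range (2 * j + 1)) :
    0 ≤ coverWeight j i := by
  have h : (i : ℝ) ≤ 2 * j + 1 := by
    exact_mod_cast (Finset.mem_range.1 hi).le
  unfold coverWeight
  apply div_nonneg <;> [linarith; positivity]

theorem sum_coverWeight (j : ℕ) :
    3 * ∑ i ∈ Finset.range (2 * j + 1), coverWeight j i =
      2 * (j : ℝ) + 1 + (2 * (j : ℝ) + 1) / (3 * (j : ℝ) + 2) := by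
  have h : ∀ m : ℕ, ∑ i ∈ Finset.range m, (2 * (j : ℝ) + 1 - i) =
      m * (2 * j + 1) - m * (m - 1) / 2 := by
    intro m
    induction m with
    | zero => simp
    | succ m ih => rw [Finset.sum_range_succ, ih]; push_cast; ring
  have h0 : (3 * (j : ℝ) + 2) ≠ 0 := by positivity
  simp only [coverWeight]
  rw [← Finset.sum_div, h]
  push_cast
  field_simp
  ring

theorem fracTotal_cover (j : ℕ) :
    fracTotal (cover j) = 2 * (j : ℝ) + 1 + (2 * (j : ℝ) + 1) / (3 * (j : ℝ) + 2) := by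
  rw [fracTotal_eq_linearCombination, cover, map_sum, ← sum_coverWeight, Finset.mul_sum]
  refine Finset.sum_congr rfl fun i _ => ?_
  simp only [map_add, Finsupp.linearCombination_single, smul_eq_mul]
  ring

theorem coverWeight_le_sum (j k : ℕ) :
    coverWeight j k ≤
      ∑ i ∈ Finset.range (2 * j + 1), if k = i then coverWeight j i else 0 := by
  rw [Finset.sum_ite_eq]
  split_ifs with h
  · exact le_rfl
  · have h' : (2 * (j : ℝ) + 1) ≤ k := by
      exact_mod_cast not_lt.1 (fun h' => h (Finset.mem_range.2 h'))
    unfold coverWeight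
    apply div_nonpos_of_nonpos_of_nonneg <;> [linarith; positivity]

theorem one_le_fracAt_cover (j : ℕ) {x : Fin 2 → ℤ} (hx : x ∈ TriGrid 2 (3 * j + 2)) :
    1 ≤ fracAt (cover j) (toReal x) := by
  obtain ⟨hx0, hx1⟩ := hx
  rw [Fin.sum_univ_two] at hx1
  obtain ⟨a, ha⟩ := Int.eq_ofNat_of_zero_le (hx0 0)
  obtain ⟨b, hb⟩ := Int.eq_ofNat_of_zero_le (hx0 1)
  obtain ⟨c, hc⟩ : ∃ c, a + b + c = 3 * j + 1 := by
    refine ⟨3 * j + 1 - (a + b), ?_⟩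
    push_cast at hx1
    omega
  have hcR : (a : ℝ) + b + c = 3 * j + 1 := by exact_mod_cast hc
  have h0 : (3 * (j : ℝ) + 2) ≠ 0 := by positivity
  have hz : ∀ i : ℕ, (a : ℝ) + b = 3 * j + 1 - i ↔ c = i := by
    intro i
    rw [← @Nat.cast_inj ℝ]
    constructor <;> intro h <;> linarith
  calc (1 : ℝ) = coverWeight j a + coverWeight j b + coverWeight j c := by
        unfold coverWeight
        field_simp
        linarith
    _ ≤ _ := add_le_add (add_le_add (coverWeight_le_sum j a) (coverWeight_le_sum j b))
        (coverWeight_le_sum j c)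
    _ = _ := by
        rw [fracAt_eq_linearCombination, cover, map_sum, ← Finset.sum_add_distrib,
          ← Finset.sum_add_distrib]
        refine Finset.sum_congr rfl fun i _ => ?_
        simp [toReal, ha, hb, hz]

theorem isFracCover_cover (j : ℕ) : IsFracCover 2 (3 * j + 2) (cover j) := by
  refine ⟨fun H => ?_, fun H hH h0 => ?_, fun x hx => one_le_fracAt_cover j hx⟩
  · rw [cover, Finsupp.finsetSum_apply]
    refine Finset.sum_nonneg fun i hi => ?_
    have h := coverWeight_nonneg hi
    simp only [Finsupp.add_apply, Finsupp.single_apply]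
    refine add_nonneg (add_nonneg ?_ ?_) ?_ <;> split_ifs <;> first | exact h | exact le_rfl
  · refine Finsupp.mem_support_iff.1 hH ?_
    rw [cover, Finsupp.finsetSum_apply]
    refine Finset.sum_eq_zero fun i _ => ?_
    obtain ⟨a, b⟩ := H
    simp only at h0
    subst h0
    simp [funext_iff, Fin.forall_fin_two]

/-! ### An optimal dual solution -/

/-- The contribution of one barycentric coordinate to the dual weight of a point. -/
def coordWeight (j i : ℕ) : ℕ := if i = 2 * j + 1 then 2 * j + 1 else 3 * i - (3 * j + 1)

/-- The dual weight of the point `(x, y)`, scaled by `(j + 1) * (3 * j + 2)`. -/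
def dualWeight (j x y : ℕ) : ℕ :=
  coordWeight j x + coordWeight j y + coordWeight j (3 * j + 1 - x - y)

/-- The values of `y` for which `(x, y)` lies in the hexagon supporting the dual solution. -/
def row (j x : ℕ) : Finset ℕ := Finset.Icc (j - x) (min (2 * j + 1) (3 * j + 1 - x))

/-- The hexagon supporting the dual solution. -/
def hexagon (j : ℕ) : Finset (ℕ × ℕ) :=
  (Finset.range (2 * j + 2) ×ˢ Finset.range (2 * j + 2)).filter
    (fun p => j ≤ p.1 + p.2 ∧ p.1 + p.2 ≤ 3 * j + 1)

theorem mem_hexagon {j : ℕ} {p : ℕ × ℕ} : p ∈ hexagon j ↔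
    p.1 ≤ 2 * j + 1 ∧ p.2 ≤ 2 * j + 1 ∧ j ≤ p.1 + p.2 ∧ p.1 + p.2 ≤ 3 * j + 1 := by
  simp only [hexagon, Finset.mem_filter, Finset.mem_product, Finset.mem_range]
  omega

theorem mem_row {j x y : ℕ} (hx : x ≤ 2 * j + 1) : y ∈ row j x ↔
    y ≤ 2 * j + 1 ∧ j ≤ x + y ∧ x + y ≤ 3 * j + 1 := by
  simp only [row, Finset.mem_Icc]
  omega

theorem two_mul_sum_coordWeight {j k : ℕ} (hk : k ≤ j) :
    2 * ∑ i ∈ Finset.range (j + 1 + k), coordWeight j i = k * (3 * k + 1) := by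
  induction k with
  | zero =>
    rw [Finset.sum_eq_zero]
    · simp
    · intro i hi
      rw [Finset.mem_range] at hi
      unfold coordWeight
      split_ifs <;> omega
  | succ k ih =>
    have h : coordWeight j (j + 1 + k) = 3 * k + 2 := by
      unfold coordWeight
      split_ifs <;> omega
    rw [← add_assoc, Finset.sum_range_succ, mul_add, ih (by omega), h]
    ring

theorem coordWeight_eq_zero {j i : ℕ} (hi : i ≤ j) : coordWeight j i = 0 := by
  unfold coordWeight
  split_ifs <;> omega

theorem sum_row_dualWeight {j x : ℕ} (hx : x ≤ 2 * j + 1) :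
    ∑ y ∈ row j x, dualWeight j x y =
      (row j x).card * coordWeight j x + 2 * ∑ y ∈ row j x, coordWeight j y := by
  have h : ∑ y ∈ row j x, coordWeight j (3 * j + 1 - x - y) = ∑ y ∈ row j x, coordWeight j y := by
    refine Finset.sum_nbij' (fun y => 3 * j + 1 - x - y) (fun y => 3 * j + 1 - x - y)
      ?_ ?_ ?_ ?_ (fun _ _ => rfl) <;> intro y hy <;> simp only [mem_row hx] at hy ⊢ <;> omega
  simp only [dualWeight, Finset.sum_add_distrib, Finset.sum_const, smul_eq_mul, h]
  ring

theorem sum_row_eq_sum_range {j x : ℕ} (hx : x ≤ 2 * j + 1) :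
    ∑ y ∈ row j x, coordWeight j y =
      ∑ y ∈ Finset.range (min (2 * j + 2) (3 * j + 2 - x)), coordWeight j y := by
  refine Finset.sum_subset (fun y hy => ?_) (fun y hy hy' => coordWeight_eq_zero ?_)
  · rw [mem_row hx] at hy
    rw [Finset.mem_range]
    omega
  · rw [mem_row hx] at hy'
    rw [Finset.mem_range] at hy
    omega

theorem sum_row_of_le {j x : ℕ} (hx : x ≤ 2 * j) :
    ∑ y ∈ row j x, dualWeight j x y = (j + 1) * (3 * j + 2) := by
  rw [sum_row_dualWeight (by omega), sum_row_eq_sum_range (by omega)]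
  obtain hxj | hxj := le_or_gt x j
  · have h1 : min (2 * j + 2) (3 * j + 2 - x) = j + 1 + j + 1 := by omega
    have h2 : coordWeight j (j + 1 + j) = 2 * j + 1 := by
      unfold coordWeight
      split_ifs <;> omega
    rw [h1, Finset.sum_range_succ, mul_add, two_mul_sum_coordWeight le_rfl, h2,
      coordWeight_eq_zero hxj]
    ring
  · obtain ⟨k, hk⟩ : ∃ k, x + k = 2 * j + 1 := ⟨2 * j + 1 - x, by omega⟩
    obtain ⟨m, rfl⟩ : ∃ m, x = j + 1 + m := ⟨x - (j + 1), by omega⟩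
    have h1 : min (2 * j + 2) (3 * j + 2 - (j + 1 + m)) = j + 1 + k := by omega
    have h2 : (row j (j + 1 + m)).card = j + 1 + k := by
      rw [row, Nat.card_Icc]
      omega
    have h3 : coordWeight j (j + 1 + m) = 3 * m + 2 := by
      unfold coordWeight
      split_ifs <;> omega
    obtain rfl : j = m + k := by omega
    rw [h1, two_mul_sum_coordWeight (by omega), h2, h3]
    ring

theorem sum_last_row (j : ℕ) :
    ∑ y ∈ row j (2 * j + 1), dualWeight j (2 * j + 1) y = (j + 1) * (2 * j + 1) := by
  have h1 : min (2 * j + 2) (3 * j + 2 - (2 * j + 1)) = j + 1 + 0 := by omega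
  have h2 : (row j (2 * j + 1)).card = j + 1 := by
    rw [row, Nat.card_Icc]
    omega
  rw [sum_row_dualWeight le_rfl, sum_row_eq_sum_range le_rfl, h1,
    two_mul_sum_coordWeight (Nat.zero_le _), h2, coordWeight, if_pos rfl]
  ring

theorem sum_row_le {j x : ℕ} (hx : x ≤ 2 * j + 1) :
    ∑ y ∈ row j x, dualWeight j x y ≤ (j + 1) * (3 * j + 2) := by
  obtain h | rfl : x ≤ 2 * j ∨ x = 2 * j + 1 := by omega
  · exact (sum_row_of_le h).le
  · rw [sum_last_row]
    exact Nat.mul_le_mul_left _ (by omega)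

theorem sum_hexagon (j : ℕ) :
    ∑ p ∈ hexagon j, dualWeight j p.1 p.2 =
      (2 * j + 1) * ((j + 1) * (3 * j + 2)) + (j + 1) * (2 * j + 1) := by
  rw [Finset.sum_finset_product (hexagon j) (Finset.range (2 * j + 2)) (row j),
    Finset.sum_range_succ, sum_last_row,
    Finset.sum_congr rfl fun x hx => sum_row_of_le (Nat.lt_succ_iff.1 (Finset.mem_range.1 hx))]
  · simp
  · rintro ⟨x, y⟩
    rw [mem_hexagon, Finset.mem_range]
    constructor
    · rintro ⟨h1, h2⟩
      exact ⟨by omega, (mem_row h1).2 h2⟩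
    · rintro ⟨h1, h2⟩
      exact ⟨by omega, (mem_row (by omega)).1 h2⟩

theorem dualWeight_le {j : ℕ} {p : ℕ × ℕ} (hp : p ∈ hexagon j) :
    dualWeight j p.1 p.2 ≤ 3 * j + 2 := by
  rw [mem_hexagon] at hp
  unfold dualWeight coordWeight
  split_ifs <;> omega

/-- A set of hexagon points on which one barycentric coordinate is constantly `c` has small dual
weight; `g` is one of the other two coordinates. -/
theorem sum_le_of_row {j c : ℕ} (hc : c ≤ 2 * j + 1) (T : Finset (ℕ × ℕ)) (g : ℕ × ℕ → ℕ)
    (hg : Set.InjOn g T) (hrow : ∀ p ∈ T, g p ∈ row j c)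
    (hval : ∀ p ∈ T, dualWeight j p.1 p.2 = dualWeight j c (g p)) :
    ∑ p ∈ T, dualWeight j p.1 p.2 ≤ (j + 1) * (3 * j + 2) := by
  rw [Finset.sum_congr rfl hval, ← Finset.sum_image (f := fun y => dualWeight j c y) hg]
  exact (Finset.sum_le_sum_of_subset (Finset.image_subset_iff.2 hrow)).trans (sum_row_le hc)

/-- A set of hexagon points on which some bounded coordinate takes pairwise non-adjacent values
has small dual weight. -/
theorem sum_le_of_sparse {j : ℕ} (T : Finset (ℕ × ℕ)) (hT : T ⊆ hexagon j) (g : ℕ × ℕ → ℕ)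
    (hg : ∀ p ∈ T, g p ≤ 2 * j + 1)
    (hsep : ∀ p ∈ T, ∀ q ∈ T, g p ≤ g q → g q ≤ g p + 1 → p = q) :
    ∑ p ∈ T, dualWeight j p.1 p.2 ≤ (j + 1) * (3 * j + 2) := by
  have hcard : T.card ≤ (Finset.range (j + 1)).card := by
    refine Finset.card_le_card_of_injOn (fun p => g p / 2) (fun p hp => ?_)
      (fun p hp q hq hpq => ?_)
    · have := hg p hp
      simp only [Finset.coe_range, Set.mem_Iio]
      omega
    · simp only at hpq
      obtain h | h := le_total (g p) (g q)
      · exact hsep p hp q hq h (by omega)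
      · exact (hsep q hq p hp h (by omega)).symm
  rw [Finset.card_range] at hcard
  calc ∑ p ∈ T, dualWeight j p.1 p.2 ≤ T.card • (3 * j + 2) :=
        Finset.sum_le_card_nsmul _ _ _ fun p hp => dualWeight_le (hT hp)
    _ ≤ (j + 1) * (3 * j + 2) := by
        rw [smul_eq_mul]
        gcongr

theorem sum_le_of_line {j : ℕ} {a b c : ℝ} (hab : a ≠ 0 ∨ b ≠ 0) (T : Finset (ℕ × ℕ))
    (hT : T ⊆ hexagon j) (hline : ∀ p ∈ T, a * p.1 + b * p.2 = c) :
    ∑ p ∈ T, dualWeight j p.1 p.2 ≤ (j + 1) * (3 * j + 2) := by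
  obtain rfl | ⟨r, hr⟩ := T.eq_empty_or_nonempty
  · simp
  have hmem : ∀ p ∈ T, _ := fun p hp => mem_hexagon.1 (hT hp)
  have hrr := hmem r hr
  have hdiff : ∀ p ∈ T, ∀ q ∈ T,
      a * (((p.1 : ℤ) - q.1 : ℤ) : ℝ) + b * (((p.2 : ℤ) - q.2 : ℤ) : ℝ) = 0 := by
    intro p hp q hq
    have h1 := hline p hp
    have h2 := hline q hq
    push_cast
    linarith
  by_cases ha : a = 0
  · have hb : b ≠ 0 := hab.resolve_left (not_not.2 ha)
    have hc : ∀ p ∈ T, p.2 = r.2 := by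
      intro p hp
      have h := hdiff p hp r hr
      rw [ha, zero_mul, zero_add, mul_eq_zero, or_iff_right hb, Int.cast_eq_zero] at h
      omega
    refine sum_le_of_row (c := r.2) (by omega) T Prod.fst (fun p hp q hq h => ?_)
      (fun p hp => ?_) (fun p hp => ?_)
    · exact Prod.ext h ((hc p hp).trans (hc q hq).symm)
    · have := hmem p hp
      have := hc p hp
      rw [mem_row (by omega)]
      omega
    · rw [hc p hp, dualWeight, dualWeight, Nat.sub_right_comm, add_comm (coordWeight j p.1)]
  by_cases hb : b = 0
  · have hc : ∀ p ∈ T, p.1 = r.1 := by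
      intro p hp
      have h := hdiff p hp r hr
      rw [hb, zero_mul, add_zero, mul_eq_zero, or_iff_right ha, Int.cast_eq_zero] at h
      omega
    refine sum_le_of_row (c := r.1) (by omega) T Prod.snd (fun p hp q hq h => ?_)
      (fun p hp => ?_) (fun p hp => by rw [hc p hp])
    · exact Prod.ext ((hc p hp).trans (hc q hq).symm) h
    · have := hmem p hp
      have := hc p hp
      rw [mem_row (by omega)]
      omega
  by_cases heq : a = b
  · have hc : ∀ p ∈ T, p.1 + p.2 = r.1 + r.2 := by
      intro p hp
      have h := hdiff p hp r hr
      rw [heq, ← mul_add, mul_eq_zero, or_iff_right hb, ← Int.cast_add, Int.cast_eq_zero] at h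
      omega
    refine sum_le_of_row (c := 3 * j + 1 - r.1 - r.2) (by omega) T Prod.snd
      (fun p hp q hq h => ?_) (fun p hp => ?_) (fun p hp => ?_)
    · have := hc p hp
      have := hc q hq
      exact Prod.ext (by omega) h
    · have := hmem p hp
      have := hc p hp
      rw [mem_row (by omega)]
      omega
    · have h1 := hmem p hp
      have h2 := hc p hp
      have h3 : 3 * j + 1 - p.1 - p.2 = 3 * j + 1 - r.1 - r.2 := by omega
      have h4 : 3 * j + 1 - (3 * j + 1 - r.1 - r.2) - p.2 = p.1 := by omega
      rw [dualWeight, dualWeight, h3, h4]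
      ring
  by_cases hstep : ∃ p ∈ T, ∃ q ∈ T, q.1 = p.1 + 1
  · obtain ⟨p, hp, q, hq, hpq⟩ := hstep
    obtain ⟨d, hd⟩ : ∃ d : ℤ, d = (q.2 : ℤ) - p.2 := ⟨_, rfl⟩
    have had : a = -(b * d) := by
      have h := hdiff q hq p hp
      rw [← hd, show ((q.1 : ℤ) - p.1) = 1 by omega] at h
      push_cast at h
      linarith
    have hd0 : d ≠ 0 := by
      rintro rfl
      exact ha (by simpa using had)
    have hd1 : d ≠ -1 := by
      rintro rfl
      exact heq (by simpa using had)
    have hslope : ∀ p ∈ T, ∀ q ∈ T, ((p.2 : ℤ) - q.2) = d * ((p.1 : ℤ) - q.1) := by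
      intro p hp q hq
      have h := hdiff p hp q hq
      have h' : b * ((((p.2 : ℤ) - q.2) - d * ((p.1 : ℤ) - q.1) : ℤ) : ℝ) = 0 := by
        rw [had] at h
        push_cast at h ⊢
        linarith
      rw [mul_eq_zero, or_iff_right hb, Int.cast_eq_zero] at h'
      omega
    obtain rfl | hd2 := eq_or_ne d 1
    · refine sum_le_of_sparse T hT (fun p => 3 * j + 1 - p.1 - p.2)
        (fun p hp => by have := hmem p hp; omega) (fun p hp q hq h1 h2 => ?_)
      have := hslope p hp q hq
      have := hmem p hp
      have := hmem q hq
      exact Prod.ext (by omega) (by omega)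
    · refine sum_le_of_sparse T hT Prod.snd (fun p hp => (hmem p hp).2.1)
        (fun p hp q hq h1 h2 => ?_)
      have h := hslope q hq p hp
      obtain h3 | h3 : (q.2 : ℤ) - p.2 = 0 ∨ (q.2 : ℤ) - p.2 = 1 := by omega
      · rw [h3, zero_eq_mul, or_iff_right hd0] at h
        exact Prod.ext (by omega) (by omega)
      · rw [h3] at h
        obtain h4 | h4 := Int.isUnit_iff.1 (IsUnit.of_mul_eq_one _ h.symm)
        · exact absurd h4 hd2
        · exact absurd h4 hd1
  · push Not at hstep
    refine sum_le_of_sparse T hT Prod.fst (fun p hp => (hmem p hp).1) (fun p hp q hq h1 h2 => ?_)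
    have h3 := hstep p hp q hq
    have h4 : q.1 = p.1 := by omega
    have h := hdiff q hq p hp
    rw [h4, sub_self, Int.cast_zero, mul_zero, zero_add, mul_eq_zero, or_iff_right hb,
      Int.cast_eq_zero] at h
    exact Prod.ext h4.symm (by omega)

/-- The grid point with the given natural coordinates. -/
def gridPoint (p : ℕ × ℕ) : Fin 2 → ℤ := ![(p.1 : ℤ), (p.2 : ℤ)]

theorem gridPoint_mem {j : ℕ} {p : ℕ × ℕ} (hp : p ∈ hexagon j) :
    gridPoint p ∈ TriGrid 2 (3 * j + 2) := by
  rw [mem_hexagon] at hp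
  refine ⟨by simp [gridPoint, Fin.forall_fin_two], ?_⟩
  simp only [gridPoint, Fin.sum_univ_two, Matrix.cons_val_zero, Matrix.cons_val_one]
  push_cast
  omega

theorem le_fracTotal {j : ℕ} {w : ((Fin 2 → ℝ) × ℝ) →₀ ℝ} (hw : IsFracCover 2 (3 * j + 2) w) :
    2 * (j : ℝ) + 1 + (2 * (j : ℝ) + 1) / (3 * (j : ℝ) + 2) ≤ fracTotal w := by
  obtain ⟨hnonneg, hne, hcov⟩ := hw
  have hD : (0 : ℝ) < ((j : ℝ) + 1) * (3 * j + 2) := by positivity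
  have key : (∑ p ∈ hexagon j, (dualWeight j p.1 p.2 : ℝ)) ≤
      ((j : ℝ) + 1) * (3 * j + 2) * fracTotal w :=
    calc (∑ p ∈ hexagon j, (dualWeight j p.1 p.2 : ℝ))
        ≤ ∑ p ∈ hexagon j, dualWeight j p.1 p.2 * fracAt w (toReal (gridPoint p)) :=
          Finset.sum_le_sum fun p hp =>
            le_mul_of_one_le_right (Nat.cast_nonneg _) (hcov _ (gridPoint_mem hp))
      _ = ∑ H ∈ w.support, w H * ∑ p ∈ (hexagon j).filter
            (fun p => ∑ i, H.1 i * toReal (gridPoint p) i = H.2),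
              (dualWeight j p.1 p.2 : ℝ) := by
          simp only [fracAt, Finset.sum_filter, Finset.mul_sum]
          rw [Finset.sum_comm]
          refine Finset.sum_congr rfl fun H _ => Finset.sum_congr rfl fun p _ => ?_
          split_ifs <;> ring
      _ ≤ ∑ H ∈ w.support, w H * (((j : ℝ) + 1) * (3 * j + 2)) := by
          refine Finset.sum_le_sum fun H hH => mul_le_mul_of_nonneg_left ?_ (hnonneg H)
          have hab : H.1 0 ≠ 0 ∨ H.1 1 ≠ 0 := by
            by_contra! h
            exact hne H hH (funext (Fin.forall_fin_two.2 h))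
          have h := sum_le_of_line (j := j) (c := H.2) hab ((hexagon j).filter
            (fun p => ∑ i, H.1 i * toReal (gridPoint p) i = H.2)) (Finset.filter_subset _ _)
            (fun p hp => by
              simpa [toReal, gridPoint, Fin.sum_univ_two] using (Finset.mem_filter.1 hp).2)
          exact_mod_cast h
      _ = _ := by rw [← Finset.sum_mul, mul_comm, fracTotal]
  have hsum : (∑ p ∈ hexagon j, (dualWeight j p.1 p.2 : ℝ)) =
      (2 * j + 1) * (((j : ℝ) + 1) * (3 * j + 2)) + ((j : ℝ) + 1) * (2 * j + 1) := by
    exact_mod_cast sum_hexagon j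
  rw [hsum] at key
  refine le_of_mul_le_mul_left (le_of_eq_of_le ?_ key) hD
  field_simp

end TriCover

theorem stmt9 (j : ℕ) :
    (∃ w : ((Fin 2 → ℝ) × ℝ) →₀ ℝ,
      IsFracCover 2 (3 * j + 2) w ∧
      fracTotal w = 2 * (j : ℝ) + 1 + (2 * (j : ℝ) + 1) / (3 * (j : ℝ) + 2)) ∧
    (∀ w : ((Fin 2 → ℝ) × ℝ) →₀ ℝ,
      IsFracCover 2 (3 * j + 2) w →
      2 * (j : ℝ) + 1 + (2 * (j : ℝ) + 1) / (3 * (j : ℝ) + 2) ≤ fracTotal w) :=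
  ⟨⟨TriCover.cover j, TriCover.isFracCover_cover j, TriCover.fracTotal_cover j⟩,
    fun _ hw => TriCover.le_fracTotal hw⟩
end

section
/- For every d ≥ 1 and n ≥ 1, the minimum cardinality of a multiset of affine hyperplanes in ℝ^d covering every point of T_d(n) at least twice equals n + ⌈n/d⌉. -/
open scoped Classical

/-- A greedy partition of `n` into `r` parts of size at most `q`, truncated at `r * q`. -/
theorem sum_range_min_sub_mul (q n r : ℕ) :
    ∑ i ∈ Finset.range r, min q (n - i * q) = min (r * q) n := by
  induction r with
  | zero => simp
  | succ r ih =>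
    rw [Finset.sum_range_succ, ih, Nat.succ_mul]
    omega

/-- If no element satisfies two of the predicates `p t`, the counts sum to at most the size. -/
theorem sum_countP_le_card {α : Type*} (C : Multiset α) (p : ℕ → α → Prop) (n : ℕ)
    (hp : ∀ H ∈ C, ∀ s t, p s H → p t H → s = t) :
    ∑ t ∈ Finset.range n, C.countP (p t) ≤ Multiset.card C := by
  induction C using Multiset.induction_on with
  | empty => simp
  | cons H C ih =>
    have h1 := ih fun K hK => hp K (Multiset.mem_cons_of_mem hK)
    have h2 : ∑ t ∈ Finset.range n, (if p t H then 1 else 0) ≤ 1 := by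
      rw [Finset.sum_boole, Nat.cast_id, Finset.card_le_one]
      intro s hs t ht
      exact hp H (Multiset.mem_cons_self H C) s t (Finset.mem_filter.1 hs).2
        (Finset.mem_filter.1 ht).2
    simp only [Multiset.countP_cons, Finset.sum_add_distrib, Multiset.card_cons]
    omega

/-- The hyperplane `H` in barycentric coordinates with coordinate sum `m` is the hyperplane
`x i = t`. -/
def IsLevel {d : ℕ} (m : ℕ) (i : Fin (d + 1)) (t : ℕ) (H : (Fin (d + 1) → ℝ) × ℝ) : Prop :=
  ∃ c : ℝ, (∀ j, H.1 (i.succAbove j) = c) ∧ H.1 i * t + c * ((m : ℝ) - t) = H.2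

theorem IsLevel.apply_eq {d m : ℕ} {i : Fin (d + 2)} {t : ℕ} {H : (Fin (d + 2) → ℝ) × ℝ}
    (h : IsLevel m i t H) {j k : Fin (d + 2)} (hj : j ≠ i) (hk : k ≠ i) : H.1 j = H.1 k := by
  obtain ⟨c, hc, -⟩ := h
  obtain ⟨j, rfl⟩ := Fin.exists_succAbove_eq hj
  obtain ⟨k, rfl⟩ := Fin.exists_succAbove_eq hk
  rw [hc, hc]

theorem IsLevel.index_unique {d m : ℕ} {i i' : Fin (d + 3)} {t t' : ℕ}
    {H : (Fin (d + 3) → ℝ) × ℝ} (hH : ∃ j k, H.1 j ≠ H.1 k)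
    (h : IsLevel m i t H) (h' : IsLevel m i' t' H) : i = i' := by
  by_contra hne
  obtain ⟨l, hl⟩ : ∃ l, l ∉ ({i, i'} : Finset (Fin (d + 3))) := by
    by_contra! hall
    have h1 := Finset.card_le_card (fun x _ => hall x : Finset.univ ⊆ ({i, i'} : Finset _))
    have h2 : ({i, i'} : Finset (Fin (d + 3))).card ≤ 2 := Finset.card_le_two
    rw [Finset.card_univ, Fintype.card_fin] at h1
    omega
  simp only [Finset.mem_insert, Finset.mem_singleton, not_or] at hl
  have key : ∀ j, H.1 j = H.1 l := fun j => by
    by_cases hj : j = i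
    · exact h'.apply_eq (by rwa [hj]) hl.2
    · exact h.apply_eq hj hl.1
  obtain ⟨j, k, hjk⟩ := hH
  exact hjk ((key j).trans (key k).symm)

theorem IsLevel.value_unique {d m : ℕ} {i : Fin (d + 2)} {t t' : ℕ}
    {H : (Fin (d + 2) → ℝ) × ℝ} (hH : ∃ j k, H.1 j ≠ H.1 k)
    (h : IsLevel m i t H) (h' : IsLevel m i t' H) : t = t' := by
  obtain ⟨c, hc, e⟩ := h
  obtain ⟨c', hc', e'⟩ := h'
  obtain rfl : c = c' := (hc 0).symm.trans (hc' 0)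
  have hne : H.1 i - c ≠ 0 := by
    intro h0
    have key : ∀ j, H.1 j = c := fun j => by
      by_cases hj : j = i
      · rw [hj]; linarith
      · obtain ⟨j, rfl⟩ := Fin.exists_succAbove_eq hj
        exact hc j
    obtain ⟨j, k, hjk⟩ := hH
    exact hjk ((key j).trans (key k).symm)
  have : (H.1 i - c) * ((t : ℝ) - t') = 0 := by linear_combination e - e'
  have := (mul_eq_zero.1 this).resolve_left hne
  exact_mod_cast sub_eq_zero.1 this

theorem le_card_cover_segment (m : ℕ) (C : Multiset ((Fin 2 → ℝ) × ℝ))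
    (hC : ∀ H ∈ C, ∃ j k, H.1 j ≠ H.1 k)
    (hcov : ∀ x : Fin 2 → ℕ, ∑ i, x i = m →
      2 ≤ C.countP fun H => ∑ i, H.1 i * (x i : ℝ) = H.2) :
    2 * (m + 1) ≤ Multiset.card C := by
  have h1 := sum_countP_le_card C
    (fun t H => H.1 0 * (t : ℝ) + H.1 1 * ((m : ℝ) - t) = H.2) (m + 1) (by
      intro H hH s t hs ht
      have hlev : ∀ u : ℕ, H.1 0 * (u : ℝ) + H.1 1 * ((m : ℝ) - u) = H.2 →
          IsLevel m 0 u H := fun u hu => ⟨H.1 1, fun j => by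
            fin_cases j; rfl, hu⟩
      exact (hlev s hs).value_unique (hC H hH) (hlev t ht))
  have h2 : ∑ t ∈ Finset.range (m + 1), 2 ≤ ∑ t ∈ Finset.range (m + 1),
      C.countP fun H => H.1 0 * (t : ℝ) + H.1 1 * ((m : ℝ) - t) = H.2 := by
    refine Finset.sum_le_sum fun t ht => ?_
    have htm : t ≤ m := Nat.lt_succ_iff.1 (Finset.mem_range.1 ht)
    have := hcov ![t, m - t] (by simp [Fin.sum_univ_two, htm])
    simpa [Fin.sum_univ_two, Nat.cast_sub htm] using this
  simp only [Finset.sum_const, Finset.card_range, smul_eq_mul] at h2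
  omega

/-- If the levels `x i = s`, `s < t`, belong to the cover but `x i = t` does not, then the
hyperplanes not parallel to `x i = t` restrict to a double cover of that level. -/
theorem exists_restricted_cover {d m t : ℕ} (i : Fin (d + 2)) (htm : t ≤ m)
    (C : Multiset ((Fin (d + 2) → ℝ) × ℝ)) (hC : ∀ H ∈ C, ∃ j k, H.1 j ≠ H.1 k)
    (hcov : ∀ x : Fin (d + 2) → ℕ, ∑ i, x i = m →
      2 ≤ C.countP fun H => ∑ i, H.1 i * (x i : ℝ) = H.2)
    (hlt : ∀ s < t, ∃ H ∈ C, IsLevel m i s H) (ht : ∀ H ∈ C, ¬ IsLevel m i t H) :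
    ∃ D : Multiset ((Fin (d + 1) → ℝ) × ℝ), Multiset.card D + t ≤ Multiset.card C ∧
      (∀ H ∈ D, ∃ j k, H.1 j ≠ H.1 k) ∧
      ∀ x : Fin (d + 1) → ℕ, ∑ i, x i = m - t →
        2 ≤ D.countP fun H => ∑ i, H.1 i * (x i : ℝ) = H.2 := by
  let P : (Fin (d + 2) → ℝ) × ℝ → Prop :=
    fun H => ∃ j k, H.1 (i.succAbove j) ≠ H.1 (i.succAbove k)
  let R : (Fin (d + 2) → ℝ) × ℝ → (Fin (d + 1) → ℝ) × ℝ :=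
    fun H => (fun j => H.1 (i.succAbove j), H.2 - H.1 i * t)
  refine ⟨(C.filter P).map R, ?_, ?_, ?_⟩
  · have hsplit := congrArg Multiset.card (Multiset.filter_add_not P C)
    rw [Multiset.card_add] at hsplit
    suffices t ≤ Multiset.card (C.filter fun H => ¬ P H) by
      rw [Multiset.card_map]; omega
    choose! f hfC hf using hlt
    have hsub : ∀ s ∈ Finset.range t, f s ∈ (C.filter fun H => ¬ P H).toFinset := by
      intro s hs
      have hs := Finset.mem_range.1 hs
      rw [Multiset.mem_toFinset, Multiset.mem_filter]
      refine ⟨hfC s hs, ?_⟩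
      rintro ⟨j, k, hjk⟩
      exact hjk ((hf s hs).apply_eq (Fin.succAbove_ne i j) (Fin.succAbove_ne i k))
    have hinj : Set.InjOn f (Finset.range t) := by
      intro s hs s' hs' e
      have hs := Finset.mem_range.1 hs
      have hs' := Finset.mem_range.1 hs'
      have h' := hf s' hs'
      rw [← e] at h'
      exact (hf s hs).value_unique (hC _ (hfC s hs)) h'
    have := Finset.card_le_card_of_injOn f hsub hinj
    rw [Finset.card_range] at this
    exact this.trans (Multiset.toFinset_card_le _)
  · intro K hK
    obtain ⟨H, hH, rfl⟩ := Multiset.mem_map.1 hK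
    exact (Multiset.mem_filter.1 hH).2
  · intro x hx
    have h2 := hcov (i.insertNth t x) (by
      rw [Fin.sum_univ_succAbove _ i]
      simp only [Fin.insertNth_apply_same, Fin.insertNth_apply_succAbove]
      omega)
    rw [Multiset.countP_map, Multiset.filter_filter, ← Multiset.countP_eq_card_filter]
    refine h2.trans (Multiset.countP_congr rfl fun H hH => propext ?_).le
    have hsum : ∑ j, H.1 j * ((i.insertNth t x : Fin (d + 2) → ℕ) j : ℝ) =
        H.1 i * t + ∑ j, H.1 (i.succAbove j) * (x j : ℝ) := by
      rw [Fin.sum_univ_succAbove _ i]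
      simp only [Fin.insertNth_apply_same, Fin.insertNth_apply_succAbove]
    rw [hsum]
    constructor
    · intro he
      refine ⟨eq_sub_of_add_eq' he, ?_⟩
      by_contra hP
      simp only [P, not_exists, not_not] at hP
      refine ht H hH ⟨H.1 (i.succAbove 0), fun j => hP j 0, ?_⟩
      rw [← he, Finset.sum_congr rfl fun j _ => by rw [hP j 0], ← Finset.mul_sum,
        ← Nat.cast_sum, hx, Nat.cast_sub htm]
    · rintro ⟨he, -⟩
      exact add_eq_of_eq_sub' he

theorem le_card_cover_simplex (d : ℕ) : ∀ (m : ℕ) (C : Multiset ((Fin (d + 2) → ℝ) × ℝ)),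
    (∀ H ∈ C, ∃ j k, H.1 j ≠ H.1 k) →
    (∀ x : Fin (d + 2) → ℕ, ∑ i, x i = m →
      2 ≤ C.countP fun H => ∑ i, H.1 i * (x i : ℝ) = H.2) →
    m + 2 + m / (d + 1) ≤ Multiset.card C := by
  induction d with
  | zero =>
    intro m C hC hcov
    have := le_card_cover_segment m C hC hcov
    rw [zero_add, Nat.div_one]
    omega
  | succ d ih =>
    intro m C hC hcov
    obtain ⟨q, hq⟩ : ∃ q, m / (d + 2) = q := ⟨_, rfl⟩
    have hqm : q * (d + 2) ≤ m := hq ▸ Nat.div_mul_le_self m (d + 2)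
    have hmq : m < (q + 1) * (d + 2) := by
      rw [← hq, Nat.add_mul, mul_comm, one_mul]
      exact Nat.lt_mul_div_succ m (by omega)
    change m + 2 + m / (d + 2) ≤ _
    rw [hq]
    by_cases hall : ∀ i : Fin (d + 3), ∀ t < q + 1, ∃ H ∈ C, IsLevel m i t H
    · choose! f hfC hf using hall
      have hinj : Set.InjOn (fun p : Fin (d + 3) × ℕ => f p.1 p.2)
          (Finset.univ ×ˢ Finset.range (q + 1) : Finset (Fin (d + 3) × ℕ)) := by
        rintro ⟨i, t⟩ hp ⟨i', t'⟩ hp' e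
        simp only [Finset.coe_product, Set.mem_prod, Finset.mem_coe, Finset.mem_univ, true_and,
          Finset.mem_range] at hp hp' e
        have h' := hf i' t' hp'
        rw [← e] at h'
        have hH := hC _ (hfC i t hp)
        obtain rfl := (hf i t hp).index_unique hH h'
        obtain rfl := (hf i t hp).value_unique hH h'
        rfl
      have hcard := Finset.card_le_card_of_injOn (t := C.toFinset) _ (fun p hp => by
        simp only [Finset.coe_product, Set.mem_prod, Finset.mem_coe, Finset.mem_univ, true_and,
          Finset.mem_range] at hp
        exact Multiset.mem_toFinset.2 (hfC p.1 p.2 hp)) hinj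
      rw [Finset.card_product, Finset.card_univ, Fintype.card_fin, Finset.card_range] at hcard
      have := hcard.trans (Multiset.toFinset_card_le C)
      nlinarith
    · push Not at hall
      obtain ⟨i, hi⟩ := hall
      have hmin := Nat.find_spec hi
      have hlt : ∀ s < Nat.find hi, ∃ H ∈ C, IsLevel m i s H := fun s hs => by
        by_contra! hno
        exact Nat.find_min hi hs ⟨hs.trans hmin.1, hno⟩
      generalize Nat.find hi = t at hmin hlt
      have htq : t ≤ q := Nat.lt_succ_iff.1 hmin.1
      have htm : t ≤ m := by nlinarith
      obtain ⟨D, hcard, hD, hDcov⟩ := exists_restricted_cover i htm C hC hcov hlt hmin.2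
      have h1 := ih (m - t) D hD hDcov
      have h2 : q ≤ (m - t) / (d + 1) := by
        rw [Nat.le_div_iff_mul_le (by omega)]
        have : q * (d + 1) + t ≤ m := by nlinarith
        omega
      omega

theorem exists_cover (d n q : ℕ) (hd : 1 ≤ d) (hnq : n ≤ d * q) :
    ∃ C : Multiset ((Fin d → ℝ) × ℝ), Multiset.card C = n + q ∧ (∀ H ∈ C, H.1 ≠ 0) ∧
      ∀ x ∈ TriGrid d n, 2 ≤ hypCount d C (toReal x) := by
  let k : Fin d → ℕ := fun i => min q (n - i * q)
  have hk : ∑ i, k i = n := by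
    rw [Fin.sum_univ_eq_sum_range (fun i => min q (n - i * q)), sum_range_min_sub_mul]
    exact min_eq_right hnq
  let A : Fin d → Multiset ((Fin d → ℝ) × ℝ) := fun i =>
    (Multiset.range (k i)).map fun t : ℕ => (Pi.single i 1, (t : ℝ))
  let B : Multiset ((Fin d → ℝ) × ℝ) :=
    (Multiset.range q).map fun t : ℕ => (1, (n : ℝ) - 1 - t)
  refine ⟨∑ i, A i + B, ?_, ?_, ?_⟩
  · simp [A, B, hk]
  · intro H hH
    rcases Multiset.mem_add.1 hH with hH | hH
    · obtain ⟨i, -, hi⟩ := Multiset.mem_sum.1 hH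
      obtain ⟨t, -, rfl⟩ := Multiset.mem_map.1 hi
      simp
    · obtain ⟨t, -, rfl⟩ := Multiset.mem_map.1 hH
      intro h0
      simpa using congrFun h0 ⟨0, hd⟩
  · rintro x ⟨hx0, hxn⟩
    have hA : ∀ i, (k i : ℤ) - x i ≤ q * hypCount d (A i) (toReal x) := by
      intro i
      by_cases hlt : x i < k i
      · have hpos : 0 < hypCount d (A i) (toReal x) := by
          refine Multiset.countP_pos.2 ⟨(Pi.single i 1, ((x i).toNat : ℝ)), ?_, ?_⟩
          · have ht : (x i).toNat < k i := by have := hx0 i; omega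
            exact Multiset.mem_map.2 ⟨(x i).toNat, Multiset.mem_range.2 ht, rfl⟩
          · have : ((x i).toNat : ℝ) = x i := by exact_mod_cast Int.toNat_of_nonneg (hx0 i)
            simp [Pi.single_apply, toReal, this]
        have hkq : k i ≤ q := min_le_left _ _
        have := hx0 i
        nlinarith
      · have : (0 : ℤ) ≤ q * hypCount d (A i) (toReal x) := by positivity
        linarith
    have hsum : (n : ℤ) - ∑ i, x i ≤ q * ∑ i, (hypCount d (A i) (toReal x) : ℤ) := by
      rw [Finset.mul_sum, ← hk, Nat.cast_sum, ← Finset.sum_sub_distrib]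
      exact Finset.sum_le_sum fun i _ => hA i
    have hcount : hypCount d (∑ i, A i + B) (toReal x) =
        ∑ i, hypCount d (A i) (toReal x) + hypCount d B (toReal x) := by
      unfold hypCount
      rw [Multiset.countP_add]
      congr 1
      exact map_sum (Multiset.countPAddMonoidHom _) A Finset.univ
    rw [hcount]
    rw [← Nat.cast_sum] at hsum
    generalize ∑ i, hypCount d (A i) (toReal x) = a at hsum
    by_cases hlt : (n : ℤ) - 1 - ∑ i, x i < q
    · have hpos : 0 < hypCount d B (toReal x) := by
        refine Multiset.countP_pos.2
          ⟨(1, (n : ℝ) - 1 - ((n - 1 - ∑ i, x i : ℤ).toNat : ℝ)), ?_, ?_⟩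
        · have ht : (n - 1 - ∑ i, x i : ℤ).toNat < q := by omega
          exact Multiset.mem_map.2 ⟨_, Multiset.mem_range.2 ht, rfl⟩
        · have : (((n - 1 - ∑ i, x i : ℤ).toNat : ℤ) : ℝ) = ((n - 1 - ∑ i, x i : ℤ) : ℝ) := by
            rw [Int.toNat_of_nonneg (by omega)]
          rw [Int.cast_natCast] at this
          rw [this]
          simp [toReal]
      have ha : a ≠ 0 := by
        rintro rfl
        simp at hsum
        omega
      omega
    · have ha : 1 < a := by
        by_contra! hle
        have : (q : ℤ) * a ≤ q := by
          have : (a : ℤ) ≤ 1 := by exact_mod_cast hle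
          nlinarith
        omega
      omega

theorem stmt12 (d n : ℕ) (hd : 1 ≤ d) (hn : 1 ≤ n) :
    (∃ C : Multiset ((Fin d → ℝ) × ℝ),
      Multiset.card C = n + (n + d - 1) / d ∧ (∀ H ∈ C, H.1 ≠ 0) ∧
      (∀ x ∈ TriGrid d n, 2 ≤ hypCount d C (toReal x))) ∧
    (∀ C : Multiset ((Fin d → ℝ) × ℝ),
      (∀ H ∈ C, H.1 ≠ 0) →
      (∀ x ∈ TriGrid d n, 2 ≤ hypCount d C (toReal x)) →
      n + (n + d - 1) / d ≤ Multiset.card C) := by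
  obtain ⟨m, rfl⟩ : ∃ m, n = m + 1 := ⟨n - 1, by omega⟩
  obtain ⟨d, rfl⟩ : ∃ e, d = e + 1 := ⟨d - 1, by omega⟩
  have hdiv : (m + 1 + (d + 1) - 1) / (d + 1) = m / (d + 1) + 1 := by
    rw [show m + 1 + (d + 1) - 1 = m + (d + 1) by omega, Nat.add_div_right _ (by omega)]
  rw [hdiv]
  refine ⟨exists_cover _ _ _ hd (Nat.lt_mul_div_succ m (by omega)), fun C hC hcov => ?_⟩
  have h := le_card_cover_simplex d m
    (C.map fun H => ((Fin.cons 0 H.1 : Fin (d + 2) → ℝ), H.2)) ?_ ?_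
  · rw [Multiset.card_map] at h
    omega
  · intro K hK
    obtain ⟨H, hH, rfl⟩ := Multiset.mem_map.1 hK
    obtain ⟨j, hj⟩ := Function.ne_iff.1 (hC H hH)
    exact ⟨j.succ, 0, by simpa using hj⟩
  · intro x hx
    rw [Fin.sum_univ_succ] at hx
    have h2 := hcov (fun i => (x i.succ : ℤ)) ⟨fun i => by positivity, by
      rw [← Nat.cast_sum]; omega⟩
    rw [Multiset.countP_map, ← Multiset.countP_eq_card_filter]
    simpa [Fin.sum_univ_succ, hypCount, toReal] using h2
end

section
/- Any multiset of planes in ℝ³ covering every point of T_3(n) at least three times has cardinality at least 2n − 2, for all n ≥ 1. -/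
open scoped Classical

/-- The plane `∑ k, v k * x k = 0` contains the line `x i = 0, x j = a` of the simplex
`∑ k, x k = N`. -/
def ContainsLine (N : ℕ) (v : Fin 4 → ℝ) (i j : Fin 4) (a : ℕ) : Prop :=
  ∀ k, k ≠ i → k ≠ j → (a : ℝ) * v j + ((N : ℝ) - a) * v k = 0

/-- The plane `∑ k, v k * x k = 0` is the facet `x i = 0` (or degenerate). -/
def IsFacet (v : Fin 4 → ℝ) (i : Fin 4) : Prop := ∀ k, k ≠ i → v k = 0

/-- The plane `∑ k, v k * x k = 0` passes through the integer point `x`. -/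
def PassesThrough (v : Fin 4 → ℝ) (x : Fin 4 → ℕ) : Prop := ∑ k, v k * (x k : ℝ) = 0

/-- The plane `∑ k, v k * x k = 0` passes through an integer point of the line `x i = 0, x j = a`
of the simplex `∑ k, x k = N`. -/
def MeetsLine (N : ℕ) (v : Fin 4 → ℝ) (i j : Fin 4) (a : ℕ) : Prop :=
  ∃ x : Fin 4 → ℕ, ∑ k, x k = N ∧ x i = 0 ∧ x j = a ∧ PassesThrough v x

theorem sum_fin_four {M : Type*} [AddCommMonoid M] {i j k l : Fin 4} (hij : i ≠ j) (hik : i ≠ k)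
    (hil : i ≠ l) (hjk : j ≠ k) (hjl : j ≠ l) (hkl : k ≠ l) (f : Fin 4 → M) :
    ∑ v, f v = f i + (f j + (f k + f l)) := by
  have h : (Finset.univ : Finset (Fin 4)) = {i, j, k, l} := by
    symm
    apply Finset.eq_univ_of_card
    simp [hij, hik, hil, hjk, hjl, hkl]
  rw [h, Finset.sum_insert (by simp [hij, hik, hil]), Finset.sum_insert (by simp [hjk, hjl]),
    Finset.sum_insert (by simp [hkl]), Finset.sum_singleton]

theorem exists_fourth : ∀ i j k : Fin 4, ∃ l, l ≠ i ∧ l ≠ j ∧ l ≠ k := by decide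

theorem eq_of_four : ∀ i j k l v : Fin 4, i ≠ j → i ≠ k → i ≠ l → j ≠ k → j ≠ l → k ≠ l →
    v ≠ i → v ≠ j → v ≠ k → v = l := by
  intro i j k l v
  omega

/-- The point `x i = 0, x j = a, x k = t` of the simplex `∑ k, x k = N`. -/
def linePoint (N : ℕ) (i j k : Fin 4) (a t : ℕ) : Fin 4 → ℕ :=
  fun v => if v = i then 0 else if v = j then a else if v = k then t else N - a - t

theorem sum_linePoint {N : ℕ} {i j k : Fin 4} (hij : i ≠ j) (hik : i ≠ k) (hjk : j ≠ k)
    {a t : ℕ} (h : a + t ≤ N) : ∑ v, linePoint N i j k a t v = N := by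
  obtain ⟨l, hli, hlj, hlk⟩ := exists_fourth i j k
  rw [sum_fin_four hij hik hli.symm hjk hlj.symm hlk.symm]
  simp only [linePoint, hij.symm, hik.symm, hjk.symm, hli, hlj, hlk, if_true, if_false]
  omega

theorem passesThrough_linePoint {N : ℕ} {v : Fin 4 → ℝ} {i j k l : Fin 4} (hij : i ≠ j)
    (hik : i ≠ k) (hil : i ≠ l) (hjk : j ≠ k) (hjl : j ≠ l) (hkl : k ≠ l)
    {a t : ℕ} (h : a + t ≤ N) : PassesThrough v (linePoint N i j k a t) ↔
      v j * a + v k * t + v l * ((N : ℝ) - a - t) = 0 := by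
  rw [PassesThrough, sum_fin_four hij hik hil hjk hjl hkl]
  simp only [linePoint, hij.symm, hik.symm, hjk.symm, hil.symm, hjl.symm, hkl.symm, if_true,
    if_false]
  have : ((N - a - t : ℕ) : ℝ) = (N : ℝ) - a - t := by
    rw [Nat.sub_sub, Nat.cast_sub h]; push_cast; ring
  rw [this]
  constructor <;> intro h <;> push_cast at * <;> linarith

theorem MeetsLine.exists_real {N : ℕ} {v : Fin 4 → ℝ} {i j k l : Fin 4} {a : ℕ} (hij : i ≠ j)
    (hik : i ≠ k) (hil : i ≠ l) (hjk : j ≠ k) (hjl : j ≠ l) (hkl : k ≠ l)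
    (h : MeetsLine N v i j a) : ∃ y z : ℝ, 0 ≤ y ∧ 0 ≤ z ∧ a + y + z = N ∧
      v j * a + v k * y + v l * z = 0 := by
  obtain ⟨x, hx, hi, hj, hp⟩ := h
  rw [PassesThrough, sum_fin_four hij hik hil hjk hjl hkl] at hp
  rw [sum_fin_four hij hik hil hjk hjl hkl] at hx
  refine ⟨x k, x l, by positivity, by positivity, ?_, ?_⟩
  · rw [← hx, hi, hj]; push_cast; ring
  · rw [hi, hj] at hp; push_cast at hp; linarith

theorem ContainsLine.meetsLine {N : ℕ} {v : Fin 4 → ℝ} {i j : Fin 4} {a : ℕ} (hij : i ≠ j)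
    (ha : a ≤ N) (h : ContainsLine N v i j a) : MeetsLine N v i j a := by
  obtain ⟨k, hki, hkj, -⟩ := exists_fourth i j i
  obtain ⟨l, hli, hlj, hlk⟩ := exists_fourth i j k
  refine ⟨linePoint N i j k a (N - a), sum_linePoint hij hki.symm hkj.symm (by omega),
    by simp [linePoint], by simp [linePoint, hij.symm], ?_⟩
  rw [passesThrough_linePoint hij hki.symm hli.symm hkj.symm hlj.symm hlk.symm (by omega)]
  have := h k hki hkj
  push_cast [ha]
  linarith

/-- A plane containing a line of a pencil of parallel lines in a facet meets no other line of
the pencil, unless the plane is the facet. -/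
theorem ContainsLine.eq_of_meetsLine {N : ℕ} {v : Fin 4 → ℝ} {i j : Fin 4} {a b : ℕ} (hij : i ≠ j)
    (ha : a < N) (h : ContainsLine N v i j a) (hf : ¬ IsFacet v i) (hb : MeetsLine N v i j b) :
    b = a := by
  obtain ⟨k, hki, hkj, -⟩ := exists_fourth i j i
  obtain ⟨l, hli, hlj, hlk⟩ := exists_fourth i j k
  obtain ⟨y, z, -, -, hyz, he⟩ :=
    hb.exists_real hij hki.symm hli.symm hkj.symm hlj.symm hlk.symm
  have h1 := h k hki hkj
  have h2 := h l hli hlj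
  have ha' : (0 : ℝ) < N - a := by
    have : (a : ℝ) < N := by exact_mod_cast ha
    linarith
  have hkl : v k = v l := by
    apply mul_left_cancel₀ ha'.ne'
    linarith
  by_contra hne
  apply hf
  have hN : (N : ℝ) ≠ 0 := by
    have : 0 < N := by omega
    positivity
  have hab : (a : ℝ) - b ≠ 0 := by
    intro h0
    apply hne
    have : (b : ℝ) = a := by linarith
    exact_mod_cast this
  have hj : v j = 0 := by
    have h3 : (N : ℝ) * (a - b) * v j = 0 := by
      rw [← hkl] at he
      have hz : z = N - b - y := by linarith
      subst hz
      linear_combination ((N : ℝ) - b) * h1 - ((N : ℝ) - a) * he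
    rcases mul_eq_zero.1 h3 with h4 | h4
    · exact absurd h4 (mul_ne_zero hN hab)
    · exact h4
  intro w hw
  by_cases hwj : w = j
  · rw [hwj, hj]
  · have := h w hw hwj
    rw [hj, mul_zero, zero_add] at this
    exact (mul_eq_zero.1 this).resolve_left ha'.ne'

theorem ContainsLine.unique {N : ℕ} {v : Fin 4 → ℝ} {i j : Fin 4} {a b : ℕ} (hij : i ≠ j)
    (ha : a < N) (hb : b ≤ N) (h : ContainsLine N v i j a) (hf : ¬ IsFacet v i)
    (h' : ContainsLine N v i j b) : b = a :=
  h.eq_of_meetsLine hij ha hf (h'.meetsLine hij hb)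

/-- A plane through two points of a line contains the line. -/
theorem eq_of_passesThrough_linePoint {N : ℕ} {v : Fin 4 → ℝ} {i j k : Fin 4} (hij : i ≠ j)
    (hik : i ≠ k) (hjk : j ≠ k) {a t u : ℕ} (hn : ¬ ContainsLine N v i j a)
    (ht : a + t ≤ N) (hu : a + u ≤ N) (h1 : PassesThrough v (linePoint N i j k a t))
    (h2 : PassesThrough v (linePoint N i j k a u)) : t = u := by
  obtain ⟨l, hli, hlj, hlk⟩ := exists_fourth i j k
  rw [passesThrough_linePoint hij hik hli.symm hjk hlj.symm hlk.symm ht] at h1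
  rw [passesThrough_linePoint hij hik hli.symm hjk hlj.symm hlk.symm hu] at h2
  by_contra hne
  apply hn
  have htu : (t : ℝ) - u ≠ 0 := fun h0 => hne (by exact_mod_cast sub_eq_zero.1 h0)
  have hkl : v k = v l := by
    apply mul_left_cancel₀ htu
    linear_combination h1 - h2
  intro w hwi hwj
  have hw : v w = v l := by
    by_cases hwk : w = k
    · rw [hwk, hkl]
    · rw [eq_of_four i j k l w hij hik hli.symm hjk hlj.symm hlk.symm hwi hwj hwk]
  rw [hw]
  rw [hkl] at h1
  linear_combination h1

/-- Double counting: `T` is covered three times by relations `R h`, all but at most one of which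
meet `T` at most once, and those in `W` not at all. -/
theorem two_mul_card_add_card_le {ι τ : Type*} (s : Finset ι) (T : Finset τ) (R : ι → τ → Prop)
    (D W : Finset ι) (hcov : ∀ t ∈ T, 3 ≤ (s.filter fun h => R h t).card) (hW : W ⊆ s)
    (hDcard : (D ∩ s).card ≤ 1) (hone : ∀ h ∈ s, h ∉ D → (T.filter fun t => R h t).card ≤ 1)
    (hzero : ∀ h ∈ W, ∀ t ∈ T, ¬ R h t) : 2 * T.card + W.card ≤ s.card := by
  rcases T.eq_empty_or_nonempty with rfl | hT
  · simpa using Finset.card_le_card hW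
  have hswap : ∑ t ∈ T, (s.filter fun h => R h t).card
      = ∑ h ∈ s, (T.filter fun t => R h t).card := by
    simp only [Finset.card_filter]
    exact Finset.sum_comm
  have hlow : 3 * T.card ≤ ∑ t ∈ T, (s.filter fun h => R h t).card := by
    rw [mul_comm, ← smul_eq_mul]
    exact Finset.card_nsmul_le_sum _ _ _ hcov
  have hup : ∑ h ∈ s, ((T.filter fun t => R h t).card + if h ∈ W then 1 else 0)
      ≤ ∑ h ∈ s, (1 + if h ∈ D then T.card else 0) := by
    apply Finset.sum_le_sum
    intro h hs
    by_cases hw : h ∈ W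
    · have : (T.filter fun t => R h t) = ∅ := Finset.filter_eq_empty_iff.2 (hzero h hw)
      simp [this, hw]
    · by_cases hd : h ∈ D
      · simp only [hw, hd, if_true, if_false]
        have := Finset.card_filter_le T fun t => R h t
        omega
      · simpa [hw, hd] using hone h hs hd
  rw [Finset.sum_add_distrib, Finset.sum_add_distrib, ← hswap, ← Finset.sum_filter,
    ← Finset.sum_filter, Finset.filter_mem_eq_inter, Finset.filter_mem_eq_inter,
    Finset.inter_eq_right.2 hW] at hup
  simp only [Finset.sum_const, smul_eq_mul, mul_one, Finset.inter_comm s D] at hup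
  have : (D ∩ s).card * T.card ≤ 1 * T.card := Nat.mul_le_mul_right _ hDcard
  omega

section Cover

variable {ι : Type*} {N : ℕ} {s : Finset ι} {α : ι → Fin 4 → ℝ}

/-- Every integer point of the simplex `∑ k, x k = N` lies on at least three planes. -/
def IsTripleCover (N : ℕ) (s : Finset ι) (α : ι → Fin 4 → ℝ) : Prop :=
  ∀ x : Fin 4 → ℕ, ∑ k, x k = N → 3 ≤ (s.filter fun h => PassesThrough (α h) x).card

theorem IsTripleCover.line_bound (hcov : IsTripleCover N s α) {i j : Fin 4} (hij : i ≠ j) {a : ℕ}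
    (ha : a ≤ N) (hone : (s.filter fun h => ContainsLine N (α h) i j a).card ≤ 1)
    {W : Finset ι} (hW : W ⊆ s) (hm : ∀ h ∈ W, ¬ MeetsLine N (α h) i j a) :
    2 * (N + 1 - a) + W.card ≤ s.card := by
  obtain ⟨k, hki, hkj, -⟩ := exists_fourth i j i
  have key := two_mul_card_add_card_le s (Finset.range (N + 1 - a))
    (fun h t => PassesThrough (α h) (linePoint N i j k a t))
    (s.filter fun h => ContainsLine N (α h) i j a) W ?_ hW ?_ ?_ ?_
  · simpa using key
  · intro t ht
    rw [Finset.mem_range] at ht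
    exact hcov _ (sum_linePoint hij hki.symm hkj.symm (by omega))
  · exact (Finset.card_le_card Finset.inter_subset_left).trans hone
  · intro h hs hd
    have hn : ¬ ContainsLine N (α h) i j a := fun hc => hd (Finset.mem_filter.2 ⟨hs, hc⟩)
    rw [Finset.card_le_one]
    intro t ht u hu
    simp only [Finset.mem_filter, Finset.mem_range] at ht hu
    exact eq_of_passesThrough_linePoint hij hki.symm hkj.symm hn (by omega) (by omega) ht.2 hu.2
  · intro h hw t ht hp
    rw [Finset.mem_range] at ht
    exact hm h hw ⟨_, sum_linePoint hij hki.symm hkj.symm (by omega), by simp [linePoint],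
      by simp [linePoint, hij.symm], hp⟩

/-- A triple cover avoiding a facet is large. -/
theorem IsTripleCover.two_mul_le_of_no_facet (hcov : IsTripleCover N s α) (i : Fin 4)
    (hf : ∀ h ∈ s, ¬ IsFacet (α h) i) : 2 * N ≤ s.card := by
  obtain ⟨j, hji, -, -⟩ := exists_fourth i i i
  have hij := hji.symm
  have hind : ∀ a, a ≤ N → 2 * N ≤ s.card ∨ 2 * a ≤
      ((Finset.range a).biUnion fun b => s.filter fun h => ContainsLine N (α h) i j b).card := by
    intro a
    induction a with
    | zero => intro _; right; simp
    | succ a ih =>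
      intro ha
      rcases ih (by omega) with h | h
      · exact Or.inl h
      by_cases hone : (s.filter fun h => ContainsLine N (α h) i j a).card ≤ 1
      · left
        have := hcov.line_bound hij (by omega : a ≤ N) hone
          (W := (Finset.range a).biUnion fun b => s.filter fun h => ContainsLine N (α h) i j b)
          (by
            intro h hh
            simp only [Finset.mem_biUnion, Finset.mem_filter] at hh
            obtain ⟨_, _, hs, _⟩ := hh
            exact hs)
          (by
            intro h hh hm
            simp only [Finset.mem_biUnion, Finset.mem_filter, Finset.mem_range] at hh
            obtain ⟨b, hb, hs, hc⟩ := hh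
            have := hc.eq_of_meetsLine hij (by omega) (hf h hs) hm
            omega)
        omega
      · right
        rw [Finset.range_add_one, Finset.biUnion_insert, Finset.card_union_of_disjoint]
        · omega
        · rw [Finset.disjoint_left]
          intro h h1 h2
          simp only [Finset.mem_biUnion, Finset.mem_filter, Finset.mem_range] at h1 h2
          obtain ⟨b, hb, hs, hc⟩ := h2
          have := hc.unique hij (by omega) (by omega) (hf h hs) h1.2
          omega
  rcases hind N le_rfl with h | h
  · exact h
  · refine h.trans (Finset.card_le_card ?_)
    intro h hh
    simp only [Finset.mem_biUnion, Finset.mem_filter] at hh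
    obtain ⟨_, _, hs, _⟩ := hh
    exact hs

end Cover

theorem exists_pair_avoiding : ∀ t : Fin 4 → Fin 4, ∃ i j, i ≠ j ∧ t i ≠ j ∧ t j ≠ i := by
  intro t
  by_contra! h
  have h01 := h 0 1 (by decide)
  have h02 := h 0 2 (by decide)
  have h03 := h 0 3 (by decide)
  have h12 := h 1 2 (by decide)
  have h13 := h 1 3 (by decide)
  have h23 := h 2 3 (by decide)
  grind

/-- The coefficients off `i, j` of a plane containing a line `x i = 0, x j = a` agree. -/
theorem ContainsLine.coeff_eq {N : ℕ} {v : Fin 4 → ℝ} {i j k l : Fin 4} {a : ℕ} (ha : a < N)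
    (h : ContainsLine N v i j a) (hki : k ≠ i) (hkj : k ≠ j) (hli : l ≠ i) (hlj : l ≠ j) :
    v k = v l := by
  have ha' : (0 : ℝ) < N - a := by
    have : (a : ℝ) < N := by exact_mod_cast ha
    linarith
  apply mul_left_cancel₀ ha'.ne'
  linarith [h k hki hkj, h l hli hlj]

/-- If the coefficient at `j` vanishes, the plane is the facet `x i = 0`. -/
theorem ContainsLine.isFacet_of_coeff_eq_zero {N : ℕ} {v : Fin 4 → ℝ} {i j : Fin 4} {a : ℕ}
    (ha : a < N) (h : ContainsLine N v i j a) (hj : v j = 0) : IsFacet v i := by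
  have ha' : (0 : ℝ) < N - a := by
    have : (a : ℝ) < N := by exact_mod_cast ha
    linarith
  intro w hw
  by_cases hwj : w = j
  · rw [hwj, hj]
  · have := h w hw hwj
    rw [hj, mul_zero, zero_add] at this
    exact (mul_eq_zero.1 this).resolve_left ha'.ne'

theorem ContainsLine.isFacet_of_coeff_eq {N : ℕ} {v : Fin 4 → ℝ} {i j k : Fin 4} {a : ℕ}
    (ha : a < N) (h : ContainsLine N v i j a) (hki : k ≠ i) (hkj : k ≠ j) (hjk : v j = v k) :
    IsFacet v i := by
  apply h.isFacet_of_coeff_eq_zero ha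
  have h1 := h k hki hkj
  have hN : (N : ℝ) ≠ 0 := by
    have : 0 < N := by omega
    positivity
  rw [← hjk] at h1
  apply mul_left_cancel₀ hN
  linear_combination h1

theorem ContainsLine.not_isFacet {N : ℕ} {v : Fin 4 → ℝ} {i j : Fin 4} {a : ℕ}
    (ha0 : 1 ≤ a) (ha : a < N) (h : ContainsLine N v i j a) (hf : ¬ IsFacet v i) (w : Fin 4) :
    ¬ IsFacet v w := by
  intro hw
  by_cases hwi : w = i
  · exact hf (hwi ▸ hw)
  apply hf
  apply h.isFacet_of_coeff_eq_zero ha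
  by_cases hwj : w = j
  · obtain ⟨k, hki, hkj, -⟩ := exists_fourth i j i
    have h1 := h k hki hkj
    rw [hw k (hwj ▸ hkj), mul_zero, add_zero] at h1
    have : (a : ℝ) ≠ 0 := by positivity
    exact (mul_eq_zero.1 h1).resolve_left this
  · exact hw j (Ne.symm hwj)

/-- A nonfacet plane through a line `x i = 0, x j = a` contains no line `x k = 0, x i = b`. -/
theorem ContainsLine.not_containsLine_of_chain {N : ℕ} {v : Fin 4 → ℝ} {i j k : Fin 4} {a b : ℕ}
    (hij : i ≠ j) (hkj : k ≠ j) (ha : a < N) (hb : b < N)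
    (h : ContainsLine N v i j a) (hf : ¬ IsFacet v i) : ¬ ContainsLine N v k i b := by
  intro h'
  obtain ⟨l, hli, hlj, hlk⟩ := exists_fourth i j k
  exact hf (h.isFacet_of_coeff_eq ha hli hlj (h'.coeff_eq hb hkj.symm hij.symm hlk hli))

theorem ContainsLine.unique_of_facets {N : ℕ} {v : Fin 4 → ℝ} {i j k : Fin 4} {a b : ℕ}
    (hij : i ≠ j) (ha : a < N) (hb : b < N)
    (h : ContainsLine N v j i a) (hf : ¬ IsFacet v j) (h' : ContainsLine N v k i b) : b = a := by
  obtain ⟨l, hli, hlj, hlk⟩ := exists_fourth i j k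
  refine h.unique hij.symm ha hb.le hf fun w hwj hwi => ?_
  rw [h.coeff_eq ha hwj hwi hlj hli]
  exact h' l hlk hli

theorem ContainsLine.swap_of_meetsLine {N : ℕ} {v : Fin 4 → ℝ} {i j : Fin 4} {a b : ℕ}
    (hij : i ≠ j) (ha : a < N) (h : ContainsLine N v i j a) (hm : MeetsLine N v j i b) :
    ContainsLine N v j i b := by
  obtain ⟨k, hki, hkj, -⟩ := exists_fourth i j i
  obtain ⟨l, hli, hlj, hlk⟩ := exists_fourth i j k
  obtain ⟨y, z, -, -, hyz, he⟩ :=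
    hm.exists_real hij.symm hkj.symm hlj.symm hki.symm hli.symm hlk.symm
  intro w hwj hwi
  rw [h.coeff_eq ha hwi hwj hki hkj]
  rw [h.coeff_eq ha hli hlj hki hkj] at he
  linear_combination he - v k * hyz

/-- The coefficients of a plane that contains a line of a facet. -/
theorem ContainsLine.exists_coeff {N : ℕ} {v : Fin 4 → ℝ} {k i : Fin 4} {b : ℕ}
    (hb : b < N) (h : ContainsLine N v k i b) (hf : ¬ IsFacet v k) :
    ∃ c : ℝ, c ≠ 0 ∧ v i = c * (b - N) ∧ ∀ w, w ≠ k → w ≠ i → v w = c * b := by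
  obtain ⟨j, hjk, hji, -⟩ := exists_fourth k i k
  have hN : (N : ℝ) ≠ 0 := by
    have : 0 < N := by omega
    positivity
  have h1 := h j hjk hji
  refine ⟨(v j - v i) / N, ?_, ?_, ?_⟩
  · intro h0
    apply hf
    rw [div_eq_zero_iff] at h0
    exact h.isFacet_of_coeff_eq hb hjk hji (sub_eq_zero.1 (h0.resolve_right hN)).symm
  · field_simp
    linear_combination h1
  · intro w hwk hwi
    rw [h.coeff_eq hb hwk hwi hjk hji]
    field_simp
    linear_combination h1

theorem ContainsLine.not_meetsLine_or {N : ℕ} {v : Fin 4 → ℝ} {i j k : Fin 4} {a b m : ℕ}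
    (hij : i ≠ j) (hki : k ≠ i) (hkj : k ≠ j) (hb0 : 1 ≤ b) (hb : b < N) (hbm : b < m)
    (h : ContainsLine N v k i b) (hf : ¬ IsFacet v k) :
    ¬ MeetsLine N v i j a ∨ ¬ MeetsLine N v j i m := by
  by_contra! hcon
  obtain ⟨h1, h2⟩ := hcon
  obtain ⟨l, hli, hlj, hlk⟩ := exists_fourth i j k
  obtain ⟨y, z, hy, hz, hyz, he⟩ :=
    h1.exists_real hij hki.symm hli.symm hkj.symm hlj.symm hlk.symm
  obtain ⟨y', z', hy', hz', hyz', he'⟩ :=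
    h2.exists_real hij.symm hkj.symm hlj.symm hki.symm hli.symm hlk.symm
  obtain ⟨c, hc, hvi, hv⟩ := h.exists_coeff hb hf
  obtain ⟨d, hd⟩ : ∃ d, v k = c * d := ⟨v k / c, by field_simp⟩
  rw [hv j hkj.symm hij.symm, hv l hlk hli, hd] at he
  rw [hvi, hv l hlk hli, hd] at he'
  have e1 : (d - b) * y = -(b * N) := by
    apply mul_left_cancel₀ hc
    linear_combination he - c * b * hyz
  have e2 : (d - b) * y' = N * (m - b) := by
    apply mul_left_cancel₀ hc
    linear_combination he' - c * b * hyz'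
  have hNpos : (0 : ℝ) < N := by exact_mod_cast (by omega : 0 < N)
  have hbpos : (0 : ℝ) < b := by exact_mod_cast hb0
  have hmb : (0 : ℝ) < m - b := by
    have : (b : ℝ) < m := by exact_mod_cast hbm
    linarith
  have hdb : 0 < d - b := by
    by_contra hle
    have := mul_nonpos_of_nonpos_of_nonneg (not_lt.1 hle) hy'
    nlinarith [mul_pos hNpos hmb]
  nlinarith [mul_nonneg hdb.le hy, mul_pos hbpos hNpos]

theorem ContainsLine.not_meetsLine_of_containsLine {N : ℕ} {v : Fin 4 → ℝ} {i j k k' : Fin 4}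
    {a b m : ℕ} (hij : i ≠ j) (hki : k ≠ i) (hkj : k ≠ j) (hki' : k' ≠ i)
    (ha : a < N) (hb : b < N) (hbm : b < m) (h : ContainsLine N v k i b) (hf : ¬ IsFacet v k)
    (h' : ContainsLine N v k' j a) : ¬ MeetsLine N v j i m := by
  obtain ⟨l, hli, hlj, hlk⟩ := exists_fourth i j k
  obtain ⟨c, hc, hvi, hv⟩ := h.exists_coeff hb hf
  by_cases hkk : k' = k
  · subst hkk
    exact absurd (h.isFacet_of_coeff_eq hb hlk hli
      (h'.coeff_eq ha hki.symm hij hlk hlj)) hf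
  · intro hm
    obtain ⟨y, z, hy, hz, hyz, he⟩ :=
      hm.exists_real hij.symm hkj.symm hlj.symm hki.symm hli.symm hlk.symm
    rw [h'.coeff_eq ha (Ne.symm hkk) hkj hki'.symm hij, hvi, hv l hlk hli] at he
    have hNpos : (N : ℝ) ≠ 0 := by
      have : 0 < N := by omega
      positivity
    have e : (m : ℝ) + y = b := by
      apply mul_left_cancel₀ (mul_ne_zero hc hNpos)
      linear_combination -he + c * b * hyz
    have : (b : ℝ) < m := by exact_mod_cast hbm
    linarith

section Cover

variable {ι : Type*} {N : ℕ} {s : Finset ι} {α : ι → Fin 4 → ℝ}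

/-- The planes that are not facets and, if `p < N`, avoid the line `x i = 0, x j = p`. -/
noncomputable def avoiding (N : ℕ) (s : Finset ι) (α : ι → Fin 4 → ℝ) (i j : Fin 4) (p : ℕ) :
    Finset ι :=
  s.filter fun h => (∀ k, ¬ IsFacet (α h) k) ∧ (p < N → ¬ MeetsLine N (α h) i j p)

theorem IsTripleCover.avoiding_bound (hcov : IsTripleCover N s α) (hα : ∀ h ∈ s, α h ≠ 0)
    (hex : ∀ k, ∃ h ∈ s, IsFacet (α h) k)
    (hfac : ∀ k, (s.filter fun h => IsFacet (α h) k).card ≤ 1) {i j : Fin 4} (hij : i ≠ j) {p : ℕ}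
    (hp : p ≤ N) (hgap : p < N → ∀ h ∈ s, ¬ IsFacet (α h) i → ¬ ContainsLine N (α h) i j p) :
    2 * (N + 1 - p) + (avoiding N s α i j p).card ≤ s.card := by
  rcases hp.lt_or_eq with hlt | rfl
  · apply hcov.line_bound hij hp
    · refine (Finset.card_le_card ?_).trans (hfac i)
      intro h hh
      rw [Finset.mem_filter] at hh ⊢
      refine ⟨hh.1, ?_⟩
      by_contra hn
      exact hgap hlt h hh.1 hn hh.2
    · exact Finset.filter_subset _ _
    · intro h hh
      exact (Finset.mem_filter.1 hh).2.2 hlt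
  · obtain ⟨f, hfs, hf⟩ := hex i
    obtain ⟨g, hgs, hg⟩ := hex j
    have hfg : f ≠ g := by
      rintro rfl
      apply hα f hfs
      funext w
      by_cases hw : w = i
      · exact hg w (hw ▸ hij)
      · exact hf w hw
    have hdisj : Disjoint ({f, g} : Finset ι) (avoiding p s α i j p) := by
      rw [Finset.disjoint_left]
      intro h hh hh'
      have hn := (Finset.mem_filter.1 hh').2.1
      simp only [Finset.mem_insert, Finset.mem_singleton] at hh
      rcases hh with rfl | rfl
      · exact hn i hf
      · exact hn j hg
    have hsub : ({f, g} : Finset ι) ∪ avoiding p s α i j p ⊆ s := by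
      apply Finset.union_subset
      · intro h hh
        simp only [Finset.mem_insert, Finset.mem_singleton] at hh
        rcases hh with rfl | rfl <;> assumption
      · exact Finset.filter_subset _ _
    have := Finset.card_le_card hsub
    rw [Finset.card_union_of_disjoint hdisj, Finset.card_pair hfg] at this
    omega

/-- The planes through the lines of level less than `q` in direction `i` of another facet `k`
compensate for the coincidences between the families `A` and `B`. -/
theorem exists_extra {i j k : Fin 4} (hij : i ≠ j) (hki : k ≠ i) (hkj : k ≠ j) {q : ℕ}
    (hq : q ≤ N) {A : Finset ι} {B : ℕ → ι}
    (hA : ∀ h ∈ A, ∃ a < N, ¬ IsFacet (α h) i ∧ ContainsLine N (α h) i j a)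
    (hB : ∀ b < q, ¬ IsFacet (α (B b)) j ∧ ContainsLine N (α (B b)) j i b)
    (hE : ∀ b < q, ∃ h ∈ s, ¬ IsFacet (α h) k ∧ ContainsLine N (α h) k i b) :
    ∃ E : Finset ι, (A ∩ (Finset.Ico 1 q).image B).card = E.card ∧
      Disjoint (A ∪ (Finset.Ico 1 q).image B) E ∧
      ∀ e ∈ E, e ∈ s ∧ ¬ IsFacet (α e) k ∧ ∃ b, 1 ≤ b ∧ b < q ∧ ContainsLine N (α e) k i b := by
  have hE' : ∃ E : ℕ → ι, ∀ b < q,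
      E b ∈ s ∧ ¬ IsFacet (α (E b)) k ∧ ContainsLine N (α (E b)) k i b := by
    refine ⟨fun b => if hb : b < q then (hE b hb).choose else B b, fun b hb => ?_⟩
    simpa only [hb, dif_pos] using (hE b hb).choose_spec
  obtain ⟨E, hE'⟩ := hE'
  have hI : A ∩ (Finset.Ico 1 q).image B = ((Finset.Ico 1 q).filter fun b => B b ∈ A).image B := by
    ext h
    simp only [Finset.mem_inter, Finset.mem_image, Finset.mem_filter]
    constructor
    · rintro ⟨h1, b, hb, rfl⟩
      exact ⟨b, ⟨hb, h1⟩, rfl⟩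
    · rintro ⟨b, ⟨hb, h1⟩, rfl⟩
      exact ⟨h1, b, hb, rfl⟩
  refine ⟨((Finset.Ico 1 q).filter fun b => B b ∈ A).image E, ?_, ?_, ?_⟩
  · rw [hI, Finset.card_image_of_injOn, Finset.card_image_of_injOn]
    · intro b hb b' hb' heq
      simp only [Finset.coe_filter, Finset.mem_Ico, Set.mem_ofPred_eq] at hb hb'
      obtain ⟨-, hf, hc⟩ := hE' b hb.1.2
      obtain ⟨-, -, hc'⟩ := hE' b' hb'.1.2
      refine (hc.unique hki (by omega) (by omega) hf ?_).symm
      rw [show E b = E b' from heq]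
      exact hc'
    · intro b hb b' hb' heq
      simp only [Finset.coe_filter, Finset.mem_Ico, Set.mem_ofPred_eq] at hb hb'
      obtain ⟨hf, hc⟩ := hB b hb.1.2
      obtain ⟨-, hc'⟩ := hB b' hb'.1.2
      refine (hc.unique hij.symm (by omega) (by omega) hf ?_).symm
      rw [show B b = B b' from heq]
      exact hc'
  · have key : ∀ b, b < q → E b ∉ A := by
      intro b hb hm
      obtain ⟨-, -, hc⟩ := hE' b hb
      obtain ⟨a, ha, hf, hc'⟩ := hA _ hm
      exact hc'.not_containsLine_of_chain hij hkj ha (by omega) hf hc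
    rw [Finset.disjoint_right]
    intro e he he'
    simp only [Finset.mem_image, Finset.mem_filter, Finset.mem_Ico] at he
    obtain ⟨b, ⟨hb, hbA⟩, rfl⟩ := he
    rcases Finset.mem_union.1 he' with hm | hm
    · exact key b hb.2 hm
    · simp only [Finset.mem_image, Finset.mem_Ico] at hm
      obtain ⟨b', hb', heq⟩ := hm
      obtain ⟨hf, hc⟩ := hB b' hb'.2
      obtain ⟨-, -, hc'⟩ := hE' b hb.2
      rw [← heq] at hc'
      have := hc.unique_of_facets hij (by omega) (by omega) hf hc'
      subst this
      exact key b hb.2 (heq ▸ hbA)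
  · intro e he
    simp only [Finset.mem_image, Finset.mem_filter, Finset.mem_Ico] at he
    obtain ⟨b, ⟨hb, -⟩, rfl⟩ := he
    obtain ⟨h1, h2, h3⟩ := hE' b hb.2
    exact ⟨h1, h2, b, hb.1, hb.2, h3⟩

theorem card_image_line {i j : Fin 4} (hij : i ≠ j) {p : ℕ} (hp : p ≤ N) {A : ℕ → ι}
    (hA : ∀ a < p, A a ∈ s ∧ ¬ IsFacet (α (A a)) i ∧ ContainsLine N (α (A a)) i j a) :
    ((Finset.Ico 1 p).image A).card = p - 1 := by
  rw [Finset.card_image_of_injOn, Nat.card_Ico]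
  intro b hb b' hb' heq
  simp only [Finset.coe_Ico, Set.mem_Ico] at hb hb'
  obtain ⟨-, hf, hc⟩ := hA b hb.2
  obtain ⟨-, -, hc'⟩ := hA b' hb'.2
  refine (hc.unique hij (by omega) (by omega) hf ?_).symm
  rw [show A b = A b' from heq]
  exact hc'

theorem mem_avoiding_of_containsLine {i j : Fin 4} (hij : i ≠ j) {a p q : ℕ} {h : ι} (hs : h ∈ s)
    (ha : 1 ≤ a) (hap : a < p) (hp : p ≤ N) (hf : ¬ IsFacet (α h) i)
    (hc : ContainsLine N (α h) i j a)
    (hgap : q < N → ∀ h ∈ s, ¬ IsFacet (α h) j → ¬ ContainsLine N (α h) j i q) :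
    h ∈ avoiding N s α i j p ∧ h ∈ avoiding N s α j i q := by
  have hn := hc.not_isFacet ha (by omega) hf
  refine ⟨Finset.mem_filter.2 ⟨hs, hn, fun _ hm => ?_⟩,
    Finset.mem_filter.2 ⟨hs, hn, fun hq hm => ?_⟩⟩
  · have := hc.eq_of_meetsLine hij (by omega) hf hm
    omega
  · exact hgap hq h hs (hn j) (hc.swap_of_meetsLine hij (by omega) hm)

theorem card_avoiding_add_card_avoiding {i j k k' : Fin 4} (hij : i ≠ j) (hki : k ≠ i)
    (hkj : k ≠ j) (hki' : k' ≠ i) (hkj' : k' ≠ j) {p q : ℕ} (hp : p ≤ N) (hq : q ≤ N)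
    (hp0 : 1 ≤ p)
    (hpgap : p < N → ∀ h ∈ s, ¬ IsFacet (α h) i → ¬ ContainsLine N (α h) i j p)
    (hqgap : q < N → ∀ h ∈ s, ¬ IsFacet (α h) j → ¬ ContainsLine N (α h) j i q)
    (hA : ∀ b < p, ∃ h ∈ s, ¬ IsFacet (α h) i ∧ ContainsLine N (α h) i j b)
    (hB : ∀ b < q, ∃ h ∈ s, ¬ IsFacet (α h) j ∧ ContainsLine N (α h) j i b)
    (hE : ∀ b < q, ∃ h ∈ s, ¬ IsFacet (α h) k ∧ ContainsLine N (α h) k i b)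
    (hE' : ∀ b < p, ∃ h ∈ s, ¬ IsFacet (α h) k' ∧ ContainsLine N (α h) k' j b) :
    2 * (p - 1) + 2 * (q - 1) ≤
      (avoiding N s α i j p).card + (avoiding N s α j i q).card := by
  have : Nonempty ι := ⟨(hA 0 hp0).choose⟩
  choose! fA hfA using hA
  choose! fB hfB using hB
  set A := (Finset.Ico 1 p).image fA with hAdef
  set B := (Finset.Ico 1 q).image fB with hBdef
  have hAmem : ∀ h ∈ A, ∃ a, 1 ≤ a ∧ a < p ∧ h ∈ s ∧ ¬ IsFacet (α h) i ∧
      ContainsLine N (α h) i j a := by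
    intro h hh
    simp only [hAdef, Finset.mem_image, Finset.mem_Ico] at hh
    obtain ⟨a, ha, rfl⟩ := hh
    exact ⟨a, ha.1, ha.2, hfA a ha.2⟩
  have hBmem : ∀ h ∈ B, ∃ a, 1 ≤ a ∧ a < q ∧ h ∈ s ∧ ¬ IsFacet (α h) j ∧
      ContainsLine N (α h) j i a := by
    intro h hh
    simp only [hBdef, Finset.mem_image, Finset.mem_Ico] at hh
    obtain ⟨a, ha, rfl⟩ := hh
    exact ⟨a, ha.1, ha.2, hfB a ha.2⟩
  obtain ⟨E, hEcard, hEdisj, hEmem⟩ := exists_extra hij hki hkj hq (A := A) (B := fB)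
    (fun h hh => by
      obtain ⟨a, -, ha, -, h1, h2⟩ := hAmem h hh
      exact ⟨a, by omega, h1, h2⟩)
    (fun b hb => (hfB b hb).2) hE
  obtain ⟨E', hEcard', hEdisj', hEmem'⟩ := exists_extra hij.symm hkj' hki' hp (A := B) (B := fA)
    (fun h hh => by
      obtain ⟨a, -, ha, -, h1, h2⟩ := hBmem h hh
      exact ⟨a, by omega, h1, h2⟩)
    (fun b hb => (hfA b hb).2) hE'
  rw [← hBdef] at hEcard hEdisj
  rw [← hAdef, Finset.inter_comm] at hEcard'
  rw [← hAdef, Finset.union_comm] at hEdisj'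
  have hAcard : A.card = p - 1 := card_image_line hij hp hfA
  have hBcard : B.card = q - 1 := card_image_line hij.symm hq hfB
  set W := avoiding N s α i j p with hW
  set W' := avoiding N s α j i q with hW'
  have hAB : A ∪ B ⊆ W ∩ W' := by
    intro h hh
    rw [Finset.mem_inter]
    rcases Finset.mem_union.1 hh with hh | hh
    · obtain ⟨a, h0, h1, h2, h3, h4⟩ := hAmem h hh
      exact mem_avoiding_of_containsLine hij h2 h0 h1 hp h3 h4 hqgap
    · obtain ⟨a, h0, h1, h2, h3, h4⟩ := hBmem h hh
      exact (mem_avoiding_of_containsLine hij.symm h2 h0 h1 hq h3 h4 hpgap).symm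
  have hEsub : E ⊆ W ∪ W' := by
    intro h hh
    obtain ⟨hs, hf, b, h1, h2, hc⟩ := hEmem h hh
    have hn := hc.not_isFacet h1 (by omega) hf
    rw [Finset.mem_union]
    rcases hc.not_meetsLine_or (a := p) hij hki hkj h1 (by omega) h2 hf with hm | hm
    · exact Or.inl (Finset.mem_filter.2 ⟨hs, hn, fun _ => hm⟩)
    · exact Or.inr (Finset.mem_filter.2 ⟨hs, hn, fun _ => hm⟩)
  have hEsub' : E' ⊆ W ∪ W' := by
    intro h hh
    obtain ⟨hs, hf, b, h1, h2, hc⟩ := hEmem' h hh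
    have hn := hc.not_isFacet h1 (by omega) hf
    rw [Finset.mem_union]
    rcases hc.not_meetsLine_or (a := q) hij.symm hkj' hki' h1 (by omega) h2 hf with hm | hm
    · exact Or.inr (Finset.mem_filter.2 ⟨hs, hn, fun _ => hm⟩)
    · exact Or.inl (Finset.mem_filter.2 ⟨hs, hn, fun _ => hm⟩)
  have hEE : E ∩ E' ⊆ W ∩ W' := by
    intro h hh
    rw [Finset.mem_inter] at hh ⊢
    obtain ⟨hs, hf, b, h1, h2, hc⟩ := hEmem h hh.1
    obtain ⟨-, hf', b', h1', h2', hc'⟩ := hEmem' h hh.2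
    have hn := hc.not_isFacet h1 (by omega) hf
    exact ⟨Finset.mem_filter.2 ⟨hs, hn, fun _ => hc'.not_meetsLine_of_containsLine hij.symm hkj'
        hki' hkj (by omega) (by omega) h2' hf' hc⟩,
      Finset.mem_filter.2 ⟨hs, hn, fun _ => hc.not_meetsLine_of_containsLine hij hki hkj hki'
        (by omega) (by omega) h2 hf hc'⟩⟩
  have hcard1 : (A ∪ B).card + (E ∪ E').card ≤ (W ∪ W').card := by
    rw [← Finset.card_union_of_disjoint (Finset.disjoint_union_right.2 ⟨hEdisj, hEdisj'⟩)]
    refine Finset.card_le_card (Finset.union_subset ?_ (Finset.union_subset hEsub hEsub'))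
    exact hAB.trans (Finset.inter_subset_left.trans Finset.subset_union_left)
  have hcard2 : (A ∪ B).card + (E ∩ E').card ≤ (W ∩ W').card := by
    rw [← Finset.card_union_of_disjoint
      (Finset.disjoint_of_subset_right Finset.inter_subset_left hEdisj)]
    exact Finset.card_le_card (Finset.union_subset hAB hEE)
  have e1 := Finset.card_union_add_card_inter W W'
  have e2 := Finset.card_union_add_card_inter E E'
  have e3 := Finset.card_union_add_card_inter A B
  omega

/-- For each line direction of a facet, the levels up to some gap lie in planes of the cover. -/
theorem exists_gap (N : ℕ) (s : Finset ι) (α : ι → Fin 4 → ℝ) (i j : Fin 4) :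
    ∃ m ≤ N, (m < N → ∀ h ∈ s, ¬ IsFacet (α h) i → ¬ ContainsLine N (α h) i j m) ∧
      ∀ b < m, ∃ h ∈ s, ¬ IsFacet (α h) i ∧ ContainsLine N (α h) i j b := by
  have hex : ∃ m, m < N → ∀ h ∈ s, ¬ IsFacet (α h) i → ¬ ContainsLine N (α h) i j m :=
    ⟨N, fun h => absurd h (lt_irrefl N)⟩
  refine ⟨Nat.find hex, Nat.find_min' hex fun h => absurd h (lt_irrefl N), Nat.find_spec hex, ?_⟩
  intro b hb
  have := Nat.find_min hex hb
  push Not at this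
  exact this.2

theorem IsTripleCover.two_mul_le_of_simple_facets (hcov : IsTripleCover N s α)
    (hα : ∀ h ∈ s, α h ≠ 0) (hfac : ∀ k, (s.filter fun h => IsFacet (α h) k).card ≤ 1) :
    2 * N ≤ s.card := by
  by_contra hlt
  have hex : ∀ k, ∃ h ∈ s, IsFacet (α h) k := by
    intro k
    by_contra! hn
    exact hlt (hcov.two_mul_le_of_no_facet k hn)
  choose m hmN hgap hlev using exists_gap N s α
  have htop : ∀ i, ∃ t, t ≠ i ∧ ∀ k, k ≠ i → m k i ≤ m t i := by
    intro i
    obtain ⟨k, hk, -⟩ := exists_fourth i i i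
    obtain ⟨t, ht, hmax⟩ := Finset.exists_max_image (Finset.univ.erase i) (fun k => m k i)
      ⟨k, by simp [hk]⟩
    exact ⟨t, by simpa using ht, fun k hk => hmax k (by simp [hk])⟩
  choose t hti htmax using htop
  obtain ⟨i, j, hij, hj, hi⟩ := exists_pair_avoiding t
  have b1 := hcov.avoiding_bound hα hex hfac hij (hmN i j) (hgap i j)
  have b2 := hcov.avoiding_bound hα hex hfac hij.symm (hmN j i) (hgap j i)
  have hp0 : 1 ≤ m i j := by omega
  have := card_avoiding_add_card_avoiding hij (hti i) hj hi (hti j) (hmN i j) (hmN j i) hp0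
    (hgap i j) (hgap j i) (hlev i j) (hlev j i)
    (fun b hb => hlev (t i) i b (hb.trans_le (htmax i j hij.symm)))
    (fun b hb => hlev (t j) j b (hb.trans_le (htmax j i hij)))
  have := hmN i j
  have := hmN j i
  omega

end Cover

theorem IsTripleCover.two_mul_le {ι : Type*} {N : ℕ} {s : Finset ι} {α : ι → Fin 4 → ℝ}
    (hcov : IsTripleCover N s α) (hα : ∀ h ∈ s, α h ≠ 0) : 2 * N ≤ s.card := by
  induction N generalizing s α with
  | zero => omega
  | succ N ih =>
    by_cases hfac : ∀ k, (s.filter fun h => IsFacet (α h) k).card ≤ 1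
    · exact hcov.two_mul_le_of_simple_facets hα hfac
    push Not at hfac
    obtain ⟨i, hi⟩ := hfac
    obtain ⟨S, hS, hScard⟩ := Finset.exists_subset_card_eq (Nat.succ_le_of_lt hi)
    have hSs : S ⊆ s := hS.trans (Finset.filter_subset _ _)
    have hcard := Finset.card_sdiff_add_card_eq_card hSs
    rcases Nat.eq_zero_or_pos N with rfl | hN
    · omega
    have hN' : (N : ℝ) ≠ 0 := by positivity
    have key : 2 * N ≤ (s \ S).card := by
      apply ih (α := fun h k => α h k + α h i / N)
      · intro x hx
        have hy := hcov (fun k => x k + if k = i then 1 else 0)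
          (by rw [Finset.sum_add_distrib, hx]; simp)
        refine hy.trans (Finset.card_le_card ?_)
        intro h hh
        rw [Finset.mem_filter] at hh ⊢
        have hpass : ∑ k, α h k * (x k : ℝ) + α h i = 0 := by
          have := hh.2
          simpa [PassesThrough, mul_add, Finset.sum_add_distrib] using this
        refine ⟨Finset.mem_sdiff.2 ⟨hh.1, fun hhS => ?_⟩, ?_⟩
        · have hf := (Finset.mem_filter.1 (hS hhS)).2
          apply hα h hh.1
          funext w
          by_cases hw : w = i
          · have h0 : ∑ k, α h k * (x k : ℝ) = α h i * x i := by
              apply Finset.sum_eq_single i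
              · intro k _ hk
                rw [hf k hk, zero_mul]
              · simp
            rw [h0] at hpass
            have h1 : α h i * (x i + 1) = 0 := by linear_combination hpass
            rw [hw]
            exact (mul_eq_zero.1 h1).resolve_right (by positivity)
          · exact hf w hw
        · have hx' : ∑ k, (x k : ℝ) = N := by exact_mod_cast hx
          simp only [PassesThrough, add_mul, Finset.sum_add_distrib]
          rw [← Finset.mul_sum, hx']
          field_simp
          linear_combination hpass
      · intro h hh h0
        apply hα h (Finset.mem_sdiff.1 hh).1
        have hi0 : α h i = 0 := by
          have := congrFun h0 i
          simp only [Pi.zero_apply] at this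
          have h1 : α h i * (1 + 1 / (N : ℝ)) = 0 := by linear_combination this
          exact (mul_eq_zero.1 h1).resolve_right (by positivity)
        funext w
        have := congrFun h0 w
        simpa [hi0] using this
    omega

theorem stmt15 (n : ℕ) (hn : 1 ≤ n)
    (C : Multiset ((Fin 3 → ℝ) × ℝ))
    (hC : ∀ H ∈ C, H.1 ≠ 0)
    (hcov : ∀ x ∈ TriGrid 3 n, 3 ≤ hypCount 3 C (toReal x)) :
    2 * n - 2 ≤ Multiset.card C := by
  obtain ⟨N, rfl⟩ : ∃ N, n = N + 1 := ⟨n - 1, by omega⟩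
  rcases Nat.eq_zero_or_pos N with rfl | hN
  · simp
  have hN' : (N : ℝ) ≠ 0 := by positivity
  let α : ((Fin 3 → ℝ) × ℝ) × ℕ → Fin 4 → ℝ :=
    fun H => Fin.cons (-(H.1.2 / N)) fun k => H.1.1 k - H.1.2 / N
  have hpass : ∀ (H : ((Fin 3 → ℝ) × ℝ) × ℕ) (x : Fin 4 → ℕ), ∑ k, x k = N →
      ∑ k, H.1.1 k * toReal (fun k : Fin 3 => (x k.succ : ℤ)) k = H.1.2 →
      PassesThrough (α H) x := by
    intro H x hx he
    have hx' : ∑ k, (x k : ℝ) = N := by exact_mod_cast hx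
    rw [Fin.sum_univ_succ] at hx'
    simp only [toReal, Int.cast_natCast] at he
    simp only [PassesThrough, α, Fin.sum_univ_succ (n := 3), Fin.cons_zero, Fin.cons_succ, sub_mul,
      Finset.sum_sub_distrib, he]
    rw [← Finset.mul_sum]
    field_simp
    linear_combination -H.1.2 * hx'
  have hcover : IsTripleCover N C.toEnumFinset α := by
    intro x hx
    have hmem : (fun k : Fin 3 => (x k.succ : ℤ)) ∈ TriGrid 3 (N + 1) := by
      refine ⟨fun k => by positivity, ?_⟩
      rw [Fin.sum_univ_succ] at hx
      have : ∑ k : Fin 3, (x k.succ : ℤ) ≤ N := by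
        exact_mod_cast (by omega : ∑ k : Fin 3, x k.succ ≤ N)
      push_cast
      linarith
    refine (hcov _ hmem).trans ?_
    have hcount : hypCount 3 C (toReal fun k : Fin 3 => (x k.succ : ℤ)) =
        (C.toEnumFinset.filter fun H =>
          ∑ k, H.1.1 k * toReal (fun k : Fin 3 => (x k.succ : ℤ)) k = H.1.2).card := by
      conv_lhs => rw [hypCount, ← Multiset.map_toEnumFinset_fst C, Multiset.countP_map]
      rfl
    rw [hcount]
    refine Finset.card_le_card ?_
    intro H hH
    rw [Finset.mem_filter] at hH ⊢
    exact ⟨hH.1, hpass H x hx hH.2⟩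
  have := hcover.two_mul_le fun H hH h0 => by
    have h1 : H.1.2 / N = 0 := by
      have := congrFun h0 0
      simpa [α] using this
    apply hC H.1 (Multiset.mem_of_mem_toEnumFinset hH)
    funext k
    have := congrFun h0 k.succ
    simpa [α, h1] using this
  rw [Multiset.card_toEnumFinset] at this
  omega
end
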